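/- There is no 6-polytope with 12 vertices and 39 edges. -/

import Mathlib

open Set

/-- A polytope: the convex hull of a finite set of points. -/
def IsPolytope {n : ℕ} (P : Set (Fin n → ℝ)) : Prop :=
  ∃ S : Finset (Fin n → ℝ), P = convexHull ℝ (S : Set (Fin n → ℝ))

/-- The affine dimension of a set: the rank of its vector span. -/
noncomputable def adim {n : ℕ} (P : Set (Fin n → ℝ)) : ℕ :=
  Module.finrank ℝ (vectorSpan ℝ P)

/-- A `d`-polytope: a polytope whose affine hull has dimension `d`. -/
def IsDPolytope (d : ℕ) {n : ℕ} (P : Set (Fin n → ℝ)) : Prop :=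
  IsPolytope P ∧ adim P = d

/-- An edge of `P`: a face (an extreme convex subset) of affine dimension 1. -/
def IsEdge {n : ℕ} (P E : Set (Fin n → ℝ)) : Prop :=
  IsExtreme ℝ P E ∧ Convex ℝ E ∧ adim E = 1

/-- `f₀ P`: the number of vertices (extreme points) of `P`. -/
noncomputable def f₀ {n : ℕ} (P : Set (Fin n → ℝ)) : ℕ :=
  (Set.extremePoints ℝ P).ncard

/-- `f₁ P`: the number of edges of `P`. -/
noncomputable def f₁ {n : ℕ} (P : Set (Fin n → ℝ)) : ℕ :=
  {E : Set (Fin n → ℝ) | IsEdge P E}.ncard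

/-- `E^d`: the set of `(f₀, f₁)` pairs realized by `d`-polytopes. -/
def fPairs (d : ℕ) : Set (ℕ × ℕ) :=
  {p | ∃ (n : ℕ) (P : Set (Fin n → ℝ)), IsDPolytope d P ∧ f₀ P = p.1 ∧ f₁ P = p.2}

namespace PolytopeGraph

open scoped Classical

section Faces

variable {E : Type*} [AddCommGroup E] [Module ℝ E]

/-- `F` is the set of points of `V` at which some linear functional attains a bound valid on `V`. -/
def IsFace (V F : Finset E) : Prop :=
  F ⊆ V ∧ ∃ (f : E →ₗ[ℝ] ℝ) (c : ℝ), (∀ v ∈ F, f v = c) ∧ ∀ v ∈ V, v ∉ F → f v < c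

/-- Every point of `V` is a vertex of the convex hull of `V`. -/
def ConvexPosition (V : Finset E) : Prop := ∀ v ∈ V, IsFace V {v}

/-- `u` and `v` are the endpoints of an edge of the convex hull of `V`. -/
def Adj (V : Finset E) (u v : E) : Prop := u ≠ v ∧ IsFace V {u, v}

/-- The neighbours of `v` in the graph of the convex hull of `V`. -/
noncomputable def nbrs (V : Finset E) (v : E) : Finset E := V.filter (Adj V v)

/-- The degree of `v` in the graph of the convex hull of `V`. -/
noncomputable def deg (V : Finset E) (v : E) : ℕ := (nbrs V v).card

/-- The sum of all degrees, i.e. twice the number of edges. -/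
noncomputable def degSum (V : Finset E) : ℕ := ∑ v ∈ V, deg V v

/-- The affine dimension of `V`. -/
noncomputable def dim (V : Finset E) : ℕ := Module.finrank ℝ (vectorSpan ℝ (V : Set E))

variable {V F G : Finset E} {u v w : E}

lemma IsFace.subset (h : IsFace V F) : F ⊆ V := h.1

lemma IsFace.inter (hF : IsFace V F) (hG : IsFace V G) : IsFace V (F ∩ G) := by
  obtain ⟨hFV, f, c, hf, hf'⟩ := hF
  obtain ⟨hGV, g, e, hg, hg'⟩ := hG
  have lef : ∀ v ∈ V, f v ≤ c := fun v hv => by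
    by_cases h : v ∈ F
    · exact (hf v h).le
    · exact (hf' v hv h).le
  have leg : ∀ v ∈ V, g v ≤ e := fun v hv => by
    by_cases h : v ∈ G
    · exact (hg v h).le
    · exact (hg' v hv h).le
  refine ⟨Finset.inter_subset_left.trans hFV, f + g, c + e, ?_, ?_⟩
  · intro v hv
    rw [Finset.mem_inter] at hv
    simp [hf v hv.1, hg v hv.2]
  · intro v hv hn
    simp only [LinearMap.add_apply]
    by_cases h : v ∈ F
    · have hvG : v ∉ G := fun h' => hn (Finset.mem_inter.2 ⟨h, h'⟩)
      linarith [lef v hv, hg' v hv hvG]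
    · linarith [leg v hv, hf' v hv h]

lemma IsFace.restrict (hG : IsFace V G) (hGF : G ⊆ F) (hFV : F ⊆ V) : IsFace F G := by
  obtain ⟨-, g, e, hg, hg'⟩ := hG
  exact ⟨hGF, g, e, hg, fun v hv hn => hg' v (hFV hv) hn⟩

lemma isFace_self (V : Finset E) : IsFace V V :=
  ⟨subset_rfl, 0, 0, by simp, fun v hv hn => absurd hv hn⟩

/-- Tilt a supporting functional `f` of the face `F` by `g` until it touches a new point. -/
lemma exists_rotate {f g : E →ₗ[ℝ] ℝ} {c e : ℝ} (hf : ∀ v ∈ F, f v = c)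
    (hf' : ∀ v ∈ V, v ∉ F → f v < c) (hne : ∃ u ∈ V, u ∉ F) (hg : ∀ v ∈ F, g v ≤ e) :
    ∃ t : ℝ, IsFace V (V.filter fun v => g v - e = t * (c - f v)) ∧
      (∀ v ∈ V, g v - e ≤ t * (c - f v)) ∧ ∃ w ∈ V, w ∉ F ∧ g w - e = t * (c - f w) := by
  obtain ⟨u, hu, huF⟩ := hne
  obtain ⟨w, hw, hmax⟩ := Finset.exists_max_image (V \ F) (fun v => (g v - e) / (c - f v))
    ⟨u, Finset.mem_sdiff.2 ⟨hu, huF⟩⟩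
  rw [Finset.mem_sdiff] at hw
  have hpos : ∀ v ∈ V, v ∉ F → 0 < c - f v := fun v hv hn => sub_pos.2 (hf' v hv hn)
  have hle : ∀ v ∈ V, g v - e ≤ (g w - e) / (c - f w) * (c - f v) := by
    intro v hv
    by_cases h : v ∈ F
    · rw [hf v h]; linarith [hg v h]
    · rw [← div_le_iff₀ (hpos v hv h)]
      exact hmax v (Finset.mem_sdiff.2 ⟨hv, h⟩)
  refine ⟨(g w - e) / (c - f w), ?_, hle, w, hw.1, hw.2, ?_⟩
  · refine ⟨Finset.filter_subset _ _, g + ((g w - e) / (c - f w)) • f,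
      e + (g w - e) / (c - f w) * c, ?_, ?_⟩
    · intro v hv
      have := (Finset.mem_filter.1 hv).2
      simp only [LinearMap.add_apply, LinearMap.smul_apply, smul_eq_mul]
      linarith
    · intro v hv hn
      have h1 := hle v hv
      have h2 : g v - e ≠ (g w - e) / (c - f w) * (c - f v) := fun h =>
        hn (Finset.mem_filter.2 ⟨hv, h⟩)
      have h3 := lt_of_le_of_ne h1 h2
      simp only [LinearMap.add_apply, LinearMap.smul_apply, smul_eq_mul]
      linarith
  · rw [div_mul_cancel₀ _ (hpos w hw.1 hw.2).ne']

lemma IsFace.trans (hF : IsFace V F) (hG : IsFace F G) : IsFace V G := by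
  obtain ⟨hFV, f, c, hf, hf'⟩ := hF
  obtain ⟨hGF, g, e, hg, hg'⟩ := hG
  by_cases hne : ∃ u ∈ V, u ∉ F
  · have hgle : ∀ v ∈ F, g v ≤ e := fun v hv => by
      by_cases h : v ∈ G
      · exact (hg v h).le
      · exact (hg' v hv h).le
    obtain ⟨t, -, hle, -⟩ := exists_rotate hf hf' hne hgle
    refine ⟨hGF.trans hFV, g + (t + 1) • f, e + (t + 1) * c, ?_, ?_⟩
    · intro v hv
      simp [hg v hv, hf v (hGF hv)]
    · intro v hv hn
      simp only [LinearMap.add_apply, LinearMap.smul_apply, smul_eq_mul]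
      by_cases h : v ∈ F
      · rw [hf v h]; linarith [hg' v h hn]
      · nlinarith [hle v hv, hf' v hv h]
  · push Not at hne
    have : F = V := Finset.Subset.antisymm hFV hne
    subst this
    exact ⟨hGF, g, e, hg, hg'⟩

lemma ConvexPosition.mono (hV : ConvexPosition V) (h : F ⊆ V) : ConvexPosition F :=
  fun v hv => (hV v (h hv)).restrict (by simpa using hv) h

lemma Adj.symm (h : Adj V u v) : Adj V v u := ⟨h.1.symm, by rw [Finset.pair_comm]; exact h.2⟩

lemma adj_comm : Adj V u v ↔ Adj V v u := ⟨Adj.symm, Adj.symm⟩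

lemma Adj.left_mem (h : Adj V u v) : u ∈ V := h.2.1 (by simp)

lemma Adj.right_mem (h : Adj V u v) : v ∈ V := h.2.1 (by simp)

lemma IsFace.adj_iff (hF : IsFace V F) : Adj F u v ↔ Adj V u v ∧ u ∈ F ∧ v ∈ F := by
  constructor
  · exact fun h => ⟨⟨h.1, hF.trans h.2⟩, h.left_mem, h.right_mem⟩
  · rintro ⟨h, hu, hv⟩
    exact ⟨h.1, h.2.restrict (by simp [Finset.insert_subset_iff, hu, hv]) hF.1⟩

lemma mem_nbrs : w ∈ nbrs V v ↔ Adj V v w := by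
  rw [nbrs, Finset.mem_filter]
  exact ⟨fun h => h.2, fun h => ⟨h.right_mem, h⟩⟩

lemma nbrs_subset : nbrs V v ⊆ V := Finset.filter_subset _ _

lemma IsFace.nbrs_eq (hF : IsFace V F) (hv : v ∈ F) : nbrs F v = nbrs V v ∩ F := by
  ext w
  simp only [mem_nbrs, hF.adj_iff, Finset.mem_inter]
  tauto

lemma IsFace.deg_le (hF : IsFace V F) (hv : v ∈ F) : deg F v ≤ deg V v := by
  rw [deg, deg, hF.nbrs_eq hv]
  exact Finset.card_le_card Finset.inter_subset_left

lemma exists_adj (hV : ConvexPosition V) (hv : v ∈ V) (hu : u ∈ V) (huv : u ≠ v) :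
    ∃ w, Adj V v w := by
  induction hn : V.card using Nat.strong_induction_on generalizing V u with
  | _ n ih =>
  subst hn
  by_cases htwo : ∀ x ∈ V, x = v ∨ x = u
  · refine ⟨u, huv.symm, ?_⟩
    have : ({v, u} : Finset E) = V := by
      ext x
      simp only [Finset.mem_insert, Finset.mem_singleton]
      exact ⟨by rintro (rfl | rfl) <;> assumption, htwo x⟩
    rw [this]
    exact isFace_self V
  push Not at htwo
  obtain ⟨x, hx, hxv, hxu⟩ := htwo
  obtain ⟨-, f, c, hf, hf'⟩ := hV v hv
  have key : ∀ y ∈ V, y ≠ v → (∃ w, Adj V v w) ∨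
      ∃ g : E →ₗ[ℝ] ℝ, (∀ z ∈ V, z ≠ y → g z < g y) ∧
        ∃ t : ℝ, 0 < t ∧ ∀ z ∈ V, g z - g v = t * (c - f z) := by
    intro y hy hyv
    obtain ⟨-, g, e, hg, hg'⟩ := hV y hy
    have hgy : g y = e := hg y (by simp)
    have hmax : ∀ z ∈ V, z ≠ y → g z < g y := fun z hz hzy => by
      rw [hgy]; exact hg' z hz (by simpa using hzy)
    obtain ⟨t, hface, hle, w, hw, hwv, hweq⟩ := exists_rotate (e := g v) hf hf'
      ⟨y, hy, by simpa using hyv⟩ (g := g) (by simp)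
    have htpos : 0 < t := by
      have h1 := hle y hy
      have h2 := hmax v hv hyv.symm
      have h3 := hf' y hy (by simpa using hyv)
      by_contra ht
      nlinarith
    set M := V.filter fun z => g z - g v = t * (c - f z) with hM
    by_cases hMV : M = V
    · right
      refine ⟨g, hmax, t, htpos, fun z hz => ?_⟩
      rw [← hMV] at hz
      exact (Finset.mem_filter.1 hz).2
    · left
      have hlt : M.card < V.card :=
        Finset.card_lt_card (Finset.ssubset_iff_subset_ne.2 ⟨hface.1, hMV⟩)
      obtain ⟨z, hz⟩ := ih M.card hlt (hV.mono hface.1)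
        (Finset.mem_filter.2 ⟨hv, by rw [hf v (by simp)]; ring⟩)
        (Finset.mem_filter.2 ⟨hw, hweq⟩) (by simpa using hwv) rfl
      exact ⟨z, (hface.adj_iff.1 hz).1⟩
  rcases key u hu huv with h | ⟨g, hg, t, ht, hgt⟩
  · exact h
  rcases key x hx hxv with h | ⟨g', hg', t', ht', hgt'⟩
  · exact h
  exfalso
  have h1 := hg x hx hxu
  have h2 := hg' u hu hxu.symm
  have e1 := hgt x hx
  have e2 := hgt u hu
  have e3 := hgt' x hx
  have e4 := hgt' u hu
  have h3 : f u < f x := by nlinarith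
  nlinarith

/-- A vertex that does not maximise a functional has a neighbour with a larger value. -/
lemma exists_adj_lt (hV : ConvexPosition V) (hv : v ∈ V) (g : E →ₗ[ℝ] ℝ) (hu : u ∈ V)
    (hlt : g v < g u) : ∃ w, Adj V v w ∧ g v < g w := by
  obtain ⟨-, f, c, hf, hf'⟩ := hV v hv
  have huv : u ≠ v := by rintro rfl; exact lt_irrefl _ hlt
  obtain ⟨t, hface, hle, w, hw, hwv, hweq⟩ := exists_rotate (e := g v) hf hf'
    ⟨u, hu, by simpa using huv⟩ (g := g) (by simp)
  have htpos : 0 < t := by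
    have h1 := hle u hu
    have h3 := hf' u hu (by simpa using huv)
    by_contra ht
    nlinarith
  obtain ⟨z, hz⟩ := exists_adj (hV.mono hface.1)
    (Finset.mem_filter.2 ⟨hv, by rw [hf v (by simp)]; ring⟩)
    (Finset.mem_filter.2 ⟨hw, hweq⟩) (by simpa using hwv)
  refine ⟨z, (hface.adj_iff.1 hz).1, ?_⟩
  have hzM := (Finset.mem_filter.1 hz.right_mem).2
  have := hf' z (hface.1 hz.right_mem) (by simpa using hz.1.symm)
  nlinarith

/-- A face through `v` is determined by the neighbours of `v` that it contains. -/
lemma IsFace.subset_of_nbrs (hV : ConvexPosition V) (hF : IsFace V F) (hG : IsFace V G)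
    (hvF : v ∈ F) (hvG : v ∈ G) (h : ∀ w ∈ F, Adj V v w → w ∈ G) : F ⊆ G := by
  intro u hu
  by_contra huG
  obtain ⟨-, g, e, hg, hg'⟩ := hG
  obtain ⟨w, hw, hlt⟩ := exists_adj_lt (hV.mono hF.1) hvF (-g) hu
    (by simpa [hg v hvG] using hg' u (hF.1 hu) huG)
  have hw' := hF.adj_iff.1 hw
  simp [hg v hvG, hg w (h w hw'.2.2 hw'.1)] at hlt

lemma IsFace.exists_adj_notMem (hV : ConvexPosition V) (hF : IsFace V F) (hne : F ≠ V)
    (hv : v ∈ F) : ∃ w ∈ V, w ∉ F ∧ Adj V v w := by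
  by_contra! h
  refine hne (Finset.Subset.antisymm hF.1 ?_)
  exact (isFace_self V).subset_of_nbrs hV hF (hF.1 hv) hv fun w hw hvw =>
    by_contra fun hn => h w hw hn hvw

/-- If all points but `w` form a face, then `w` is adjacent to all of them. -/
lemma adj_of_isFace_erase (hV : ConvexPosition V) (hF : IsFace V (V.erase w)) (hw : w ∈ V)
    (hu : u ∈ V) (huw : u ≠ w) : Adj V u w := by
  obtain ⟨-, f, c, hf, hf'⟩ := hF
  obtain ⟨-, g, e, hg, hg'⟩ := hV u hu
  have hfw : f w < c := hf' w hw (by simp)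
  have hpos : 0 < c - f w := sub_pos.2 hfw
  have hgu : g u = e := hg u (by simp)
  set t := (g w - e) / (c - f w)
  have ht : t * (c - f w) = g w - e := div_mul_cancel₀ _ hpos.ne'
  refine ⟨huw, by simp [Finset.insert_subset_iff, hu, hw], g + t • f, e + t * c, ?_, ?_⟩
  · intro v hv
    simp only [Finset.mem_insert, Finset.mem_singleton] at hv
    simp only [LinearMap.add_apply, LinearMap.smul_apply, smul_eq_mul]
    rcases hv with rfl | rfl
    · rw [hgu, hf v (Finset.mem_erase.2 ⟨huw, hu⟩)]
    · linarith
  · intro v hv hn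
    simp only [Finset.mem_insert, Finset.mem_singleton, not_or] at hn
    have h1 := hg' v hv (by simpa using hn.1)
    simp only [LinearMap.add_apply, LinearMap.smul_apply, smul_eq_mul]
    rw [hf v (Finset.mem_erase.2 ⟨hn.2, hv⟩)]
    linarith

end Faces

section Counting

variable {E : Type*} [AddCommGroup E] [Module ℝ E] {V F A : Finset E} {u v w : E}

lemma degSum_add_eq (hA : A ⊆ V) :
    degSum V + ∑ s ∈ V \ A, (nbrs V s ∩ (V \ A)).card =
      ∑ v ∈ A, (nbrs V v ∩ A).card + 2 * ∑ s ∈ V \ A, deg V s := by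
  have hdeg : ∀ v, deg V v = (nbrs V v ∩ A).card + (nbrs V v ∩ (V \ A)).card := by
    intro v
    rw [deg, ← Finset.card_union_of_disjoint, ← Finset.inter_union_distrib_left,
      Finset.union_sdiff_of_subset hA, Finset.inter_eq_left.2 nbrs_subset]
    exact Finset.disjoint_of_subset_left Finset.inter_subset_right
      (Finset.disjoint_of_subset_right Finset.inter_subset_right Finset.disjoint_sdiff)
  have hcross : ∑ v ∈ A, (nbrs V v ∩ (V \ A)).card = ∑ s ∈ V \ A, (nbrs V s ∩ A).card := by
    have h := Finset.sum_card_bipartiteAbove_eq_sum_card_bipartiteBelow (s := A) (t := V \ A)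
      (Adj V)
    convert h using 2 with v hv s hs
    · congr 1
      ext w
      simp only [Finset.mem_inter, mem_nbrs, Finset.bipartiteAbove, Finset.mem_filter]
      tauto
    · congr 1
      ext w
      simp only [Finset.mem_inter, mem_nbrs, Finset.bipartiteBelow, Finset.mem_filter]
      rw [adj_comm]
      tauto
  have hsplit : degSum V = ∑ v ∈ A, deg V v + ∑ s ∈ V \ A, deg V s := by
    rw [degSum, add_comm, Finset.sum_sdiff hA]
  have h1 : ∑ v ∈ A, deg V v = ∑ v ∈ A, (nbrs V v ∩ A).card +
      ∑ v ∈ A, (nbrs V v ∩ (V \ A)).card := by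
    rw [← Finset.sum_add_distrib]; exact Finset.sum_congr rfl fun v _ => hdeg v
  have h2 : ∑ v ∈ V \ A, deg V v = ∑ v ∈ V \ A, (nbrs V v ∩ A).card +
      ∑ v ∈ V \ A, (nbrs V v ∩ (V \ A)).card := by
    rw [← Finset.sum_add_distrib]; exact Finset.sum_congr rfl fun v _ => hdeg v
  omega

lemma IsFace.degSum_eq (hF : IsFace V F) : degSum F = ∑ v ∈ F, (nbrs V v ∩ F).card :=
  Finset.sum_congr rfl fun v hv => by rw [deg, hF.nbrs_eq hv]

lemma card_nbrs_inter_lt {S : Finset E} (hv : v ∈ S) : (nbrs V v ∩ S).card < S.card := by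
  refine Finset.card_lt_card (Finset.ssubset_iff_subset_ne.2 ⟨Finset.inter_subset_right, ?_⟩)
  intro h
  rw [← h, Finset.mem_inter, mem_nbrs] at hv
  exact hv.1.1 rfl

lemma sum_card_nbrs_inter_add_le (S : Finset E) :
    ∑ s ∈ S, (nbrs V s ∩ S).card + S.card ≤ S.card * S.card := by
  have h : ∑ s ∈ S, ((nbrs V s ∩ S).card + 1) ≤ ∑ _s ∈ S, S.card :=
    Finset.sum_le_sum fun s hs => card_nbrs_inter_lt hs
  simpa [Finset.sum_add_distrib] using h

/-- Counting edges by means of a face, when every remaining vertex has degree at least `d`. -/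
lemma IsFace.le_degSum (hF : IsFace V F) {d L m : ℕ} (hd : ∀ s ∈ V \ F, d ≤ deg V s)
    (hL : L ≤ degSum F) (hm : (V \ F).card = m) :
    L + 2 * (m * d) + m ≤ degSum V + m * m := by
  subst hm
  have h1 := degSum_add_eq hF.1
  rw [← hF.degSum_eq] at h1
  have h2 := sum_card_nbrs_inter_add_le (V := V) (V \ F)
  have h3 : (V \ F).card * d ≤ ∑ s ∈ V \ F, deg V s := by
    simpa using Finset.card_nsmul_le_sum _ _ _ hd
  omega

/-- The equality case of `IsFace.le_degSum`. -/
lemma IsFace.eq_of_degSum_le (hF : IsFace V F) {d L m : ℕ} (hd : ∀ s ∈ V \ F, d ≤ deg V s)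
    (hL : L ≤ degSum F) (hm : (V \ F).card = m)
    (hle : degSum V + m * m ≤ L + 2 * (m * d) + m) :
    degSum F = L ∧ (∀ s ∈ V \ F, deg V s = d) ∧
      ∀ s ∈ V \ F, ∀ r ∈ V \ F, s ≠ r → Adj V s r := by
  subst hm
  have h1 := degSum_add_eq hF.1
  rw [← hF.degSum_eq] at h1
  have h2 := sum_card_nbrs_inter_add_le (V := V) (V \ F)
  have h3 : (V \ F).card * d ≤ ∑ s ∈ V \ F, deg V s := by
    simpa using Finset.card_nsmul_le_sum _ _ _ hd
  refine ⟨by omega, ?_, ?_⟩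
  · have h4 : ∑ s ∈ V \ F, d = ∑ s ∈ V \ F, deg V s := by
      rw [Finset.sum_const, smul_eq_mul]; omega
    exact fun s hs => ((Finset.sum_eq_sum_iff_of_le hd).1 h4 s hs).symm
  · have h5 : ∑ s ∈ V \ F, ((nbrs V s ∩ (V \ F)).card + 1) = ∑ s ∈ V \ F, (V \ F).card := by
      rw [Finset.sum_add_distrib]
      simp only [Finset.sum_const, smul_eq_mul, mul_one]
      omega
    intro s hs r hr hsr
    have h6 := (Finset.sum_eq_sum_iff_of_le fun s hs => card_nbrs_inter_lt hs).1 h5 s hs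
    have h7 : nbrs V s ∩ (V \ F) = (V \ F).erase s := by
      refine Finset.eq_of_subset_of_card_le (fun x hx => ?_) ?_
      · rw [Finset.mem_inter, mem_nbrs] at hx
        exact Finset.mem_erase.2 ⟨hx.1.1.symm, hx.2⟩
      · rw [Finset.card_erase_of_mem hs]; omega
    have : r ∈ nbrs V s ∩ (V \ F) := by
      rw [h7]; exact Finset.mem_erase.2 ⟨hsr.symm, hr⟩
    exact mem_nbrs.1 (Finset.mem_inter.1 this).1

end Counting

section Dimension

variable {E : Type*} [AddCommGroup E] [Module ℝ E] {V F G R : Finset E} {u v w : E}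

instance finiteDimensional_vectorSpan_coe (V : Finset E) :
    FiniteDimensional ℝ (vectorSpan ℝ (V : Set E)) :=
  finiteDimensional_vectorSpan_of_finite ℝ V.finite_toSet

lemma sub_mem_span (hu : u ∈ V) (hv : v ∈ V) : u - v ∈ vectorSpan ℝ (V : Set E) :=
  vsub_mem_vectorSpan ℝ (Finset.mem_coe.2 hu) (Finset.mem_coe.2 hv)

lemma vectorSpan_le_iff {S : Submodule ℝ E} (hv : v ∈ V) :
    vectorSpan ℝ (V : Set E) ≤ S ↔ ∀ u ∈ V, u - v ∈ S := by
  rw [vectorSpan_eq_span_vsub_set_right ℝ (Finset.mem_coe.2 hv), Submodule.span_le]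
  simp [Set.subset_def]

lemma vectorSpan_mono_finset (h : F ⊆ V) :
    vectorSpan ℝ (F : Set E) ≤ vectorSpan ℝ (V : Set E) :=
  vectorSpan_mono ℝ (Finset.coe_subset.2 h)

lemma IsFace.dim_lt (hF : IsFace V F) (hne : F ≠ V) (hv : v ∈ F) : dim F < dim V := by
  obtain ⟨hFV, f, c, hf, hf'⟩ := hF
  obtain ⟨u, hu, huF⟩ := Finset.exists_of_ssubset (Finset.ssubset_iff_subset_ne.2 ⟨hFV, hne⟩)
  have hker : vectorSpan ℝ (F : Set E) ≤ LinearMap.ker f := by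
    rw [vectorSpan_le_iff hv]
    intro x hx
    simp [hf x hx, hf v hv]
  refine Submodule.finrank_lt_finrank_of_lt
    (lt_of_le_of_ne (vectorSpan_mono_finset hFV) fun h => ?_)
  have h1 := sub_mem_span hu (hFV hv)
  rw [← h] at h1
  have h2 := hker h1
  rw [LinearMap.mem_ker, map_sub, hf v hv] at h2
  linarith [hf' u hu huF]

lemma dim_le_succ {x : E}
    (h : vectorSpan ℝ (V : Set E) ≤ vectorSpan ℝ (F : Set E) ⊔ Submodule.span ℝ {x}) :
    dim V ≤ dim F + 1 := by
  have h1 := Submodule.finrank_mono h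
  have h2 := Submodule.finrank_add_le_finrank_add_finrank (vectorSpan ℝ (F : Set E))
    (Submodule.span ℝ {x})
  have h3 : Module.finrank ℝ (Submodule.span ℝ {x}) ≤ 1 := by
    simpa using finrank_span_le_card (R := ℝ) ({x} : Set E)
  unfold dim
  omega

lemma dim_lt_card (hv : v ∈ V) : dim V < V.card := by
  have hpos : 0 < V.card := Finset.card_pos.2 ⟨v, hv⟩
  obtain ⟨n, hn⟩ := Nat.exists_eq_succ_of_ne_zero hpos.ne'
  have := finrank_vectorSpan_image_finset_le ℝ (id : E → E) V hn
  rw [Finset.image_id] at this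
  unfold dim
  omega

lemma span_nbrs (hV : ConvexPosition V) (hv : v ∈ V) :
    vectorSpan ℝ (V : Set E) ≤ Submodule.span ℝ ((nbrs V v).image (· - v) : Finset E) := by
  rw [vectorSpan_le_iff hv]
  intro u hu
  by_contra hn
  obtain ⟨g, hgu, hg⟩ := Submodule.exists_le_ker_of_notMem hn
  have hzero : ∀ w, Adj V v w → g w = g v := fun w hw => by
    have : w - v ∈ LinearMap.ker g := hg (Submodule.subset_span (by
      rw [Finset.coe_image]
      exact ⟨w, Finset.mem_coe.2 (mem_nbrs.2 hw), rfl⟩))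
    rwa [LinearMap.mem_ker, map_sub, sub_eq_zero] at this
  rw [map_sub, sub_ne_zero] at hgu
  rcases lt_or_gt_of_ne hgu with h | h
  · obtain ⟨w, hw, hlt⟩ := exists_adj_lt hV hv (-g) hu (by simpa using h)
    simp [hzero w hw] at hlt
  · obtain ⟨w, hw, hlt⟩ := exists_adj_lt hV hv g hu h
    simp [hzero w hw] at hlt

lemma dim_le_deg (hV : ConvexPosition V) (hv : v ∈ V) : dim V ≤ deg V v := by
  refine (Submodule.finrank_mono (span_nbrs hV hv)).trans ?_
  exact (finrank_span_finset_le_card _).trans Finset.card_image_le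

/-- A polytope of positive dimension has a facet. -/
lemma exists_facet (hV : ConvexPosition V) (hdim : 0 < dim V) :
    ∃ F, IsFace V F ∧ F.Nonempty ∧ dim F + 1 = dim V := by
  have hne : V.Nonempty := by
    by_contra h
    rw [Finset.not_nonempty_iff_eq_empty] at h
    subst h
    rw [dim, Finset.coe_empty, vectorSpan_empty, finrank_bot] at hdim
    exact hdim.false
  obtain ⟨v, hv⟩ := hne
  have hcard := dim_lt_card hv
  have hmem : ({v} : Finset E) ∈ V.powerset.filter fun F => IsFace V F ∧ F.Nonempty ∧ F ≠ V := by
    refine Finset.mem_filter.2 ⟨by simpa using hv, hV v hv, by simp, fun h => ?_⟩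
    rw [← h] at hcard hdim
    simp at hcard
    omega
  obtain ⟨F, hF, hmax⟩ := Finset.exists_max_image _ Finset.card ⟨_, hmem⟩
  obtain ⟨-, hface, ⟨p, hp⟩, hFV⟩ := Finset.mem_filter.1 hF
  refine ⟨F, hface, ⟨p, hp⟩, le_antisymm (hface.dim_lt hFV hp) ?_⟩
  obtain ⟨-, f, c, hf, hf'⟩ := id hface
  obtain ⟨u, hu, huF⟩ := Finset.exists_of_ssubset (Finset.ssubset_iff_subset_ne.2 ⟨hface.1, hFV⟩)
  refine dim_le_succ (x := u - p) ?_
  rw [vectorSpan_le_iff (hface.1 hp)]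
  intro x hx
  by_contra hn
  obtain ⟨g, hgx, hg⟩ := Submodule.exists_le_ker_of_notMem hn
  have hgF : ∀ y ∈ F, g y = g p := fun y hy => by
    have : y - p ∈ LinearMap.ker g := hg (Submodule.mem_sup_left (sub_mem_span hy hp))
    rwa [LinearMap.mem_ker, map_sub, sub_eq_zero] at this
  have hgu : g u = g p := by
    have : u - p ∈ LinearMap.ker g :=
      hg (Submodule.mem_sup_right (Submodule.mem_span_singleton_self _))
    rwa [LinearMap.mem_ker, map_sub, sub_eq_zero] at this
  obtain ⟨t, hface', -, w, hw, hwF, hwt⟩ :=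
    exists_rotate hf hf' ⟨u, hu, huF⟩ fun v hv => (hgF v hv).le
  set F' := V.filter fun v => g v - g p = t * (c - f v) with hF'
  have hsub : F ⊆ F' := fun y hy =>
    Finset.mem_filter.2 ⟨hface.1 hy, by rw [hf y hy, hgF y hy]; ring⟩
  have hwF' : w ∈ F' := Finset.mem_filter.2 ⟨hw, hwt⟩
  have hlt : F.card < F'.card :=
    Finset.card_lt_card (Finset.ssubset_iff_of_subset hsub |>.2 ⟨w, hwF', hwF⟩)
  have hF'V : F' ≠ V := by
    intro h
    have h1 : u ∈ F' := h ▸ hu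
    have h2 : x ∈ F' := h ▸ hx
    have h3 := (Finset.mem_filter.1 h1).2
    have h4 := (Finset.mem_filter.1 h2).2
    have h5 := hf' u hu huF
    have ht : t = 0 := by
      rw [hgu, sub_self] at h3
      rcases mul_eq_zero.1 h3.symm with h | h
      · exact h
      · linarith
    rw [map_sub] at hgx
    exact hgx (by rw [h4, ht, zero_mul])
  have := hmax F' (Finset.mem_filter.2 ⟨Finset.mem_powerset.2 hface'.1, hface', ⟨w, hwF'⟩, hF'V⟩)
  omega

/-- A face of a proper face `F` is the intersection of `F` with another face. -/
lemma IsFace.exists_inter_eq (hF : IsFace V F) (hne : F ≠ V) (hR : IsFace F R) :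
    ∃ G, IsFace V G ∧ G ∩ F = R ∧ ∃ w ∈ G, w ∉ F := by
  obtain ⟨hFV, f, c, hf, hf'⟩ := hF
  obtain ⟨hRF, g, e, hg, hg'⟩ := hR
  obtain ⟨u, hu, huF⟩ := Finset.exists_of_ssubset (Finset.ssubset_iff_subset_ne.2 ⟨hFV, hne⟩)
  have hgle : ∀ v ∈ F, g v ≤ e := fun v hv => by
    by_cases h : v ∈ R
    · exact (hg v h).le
    · exact (hg' v hv h).le
  obtain ⟨t, hface, -, w, hw, hwF, hwt⟩ := exists_rotate hf hf' ⟨u, hu, huF⟩ hgle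
  refine ⟨_, hface, ?_, w, Finset.mem_filter.2 ⟨hw, hwt⟩, hwF⟩
  ext x
  rw [Finset.mem_inter, Finset.mem_filter]
  constructor
  · rintro ⟨⟨-, hx⟩, hxF⟩
    by_contra hxR
    rw [hf x hxF] at hx
    linarith [hg' x hxF hxR]
  · intro hx
    exact ⟨⟨hFV (hRF hx), by rw [hg x hx, hf x (hRF hx)]; ring⟩, hRF hx⟩

/-- At a simple vertex, each neighbour is avoided by a facet through all the other ones. -/
lemma exists_facet_of_simple (hV : ConvexPosition V) (hdeg : deg V v = dim V) (hvw : Adj V v w) :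
    ∃ F, IsFace V F ∧ dim F + 1 = dim V ∧ v ∈ F ∧ w ∉ F ∧ ∀ x, Adj V v x → x ≠ w → x ∈ F := by
  have hv := hvw.left_mem
  set N := ((nbrs V v).erase w).image (· - v) with hN
  have hNcard : N.card + 1 ≤ dim V := by
    rw [← hdeg, deg, ← Finset.card_erase_add_one (mem_nbrs.2 hvw)]
    exact Nat.succ_le_succ Finset.card_image_le
  have hspan : vectorSpan ℝ (V : Set E) ≤
      Submodule.span ℝ (N : Set E) ⊔ Submodule.span ℝ {w - v} := by
    refine (span_nbrs hV hv).trans ?_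
    rw [← Submodule.span_union]
    refine Submodule.span_mono ?_
    intro x hx
    rw [Finset.coe_image] at hx
    obtain ⟨y, hy, rfl⟩ := hx
    by_cases hyw : y = w
    · right; simp [hyw]
    · left
      rw [hN, Finset.coe_image]
      exact ⟨y, Finset.mem_coe.2 (Finset.mem_erase.2 ⟨hyw, hy⟩), rfl⟩
  have hnot : w - v ∉ Submodule.span ℝ (N : Set E) := by
    intro h
    have h1 : vectorSpan ℝ (V : Set E) ≤ Submodule.span ℝ (N : Set E) := by
      refine hspan.trans (sup_le le_rfl ?_)
      simpa using h
    have h2 := (Submodule.finrank_mono h1).trans (finrank_span_finset_le_card _)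
    unfold dim at hNcard
    omega
  obtain ⟨g, hgw, hg⟩ := Submodule.exists_le_ker_of_notMem hnot
  have key : ∃ g : E →ₗ[ℝ] ℝ, g w < g v ∧ ∀ x, Adj V v x → x ≠ w → g x = g v := by
    have hzero : ∀ x, Adj V v x → x ≠ w → g x = g v := fun x hx hxw => by
      have : x - v ∈ LinearMap.ker g := hg (Submodule.subset_span (by
        rw [hN, Finset.coe_image]
        exact ⟨x, Finset.mem_coe.2 (Finset.mem_erase.2 ⟨hxw, mem_nbrs.2 hx⟩), rfl⟩))
      rwa [LinearMap.mem_ker, map_sub, sub_eq_zero] at this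
    rw [map_sub, sub_ne_zero] at hgw
    rcases lt_or_gt_of_ne hgw with h | h
    · exact ⟨g, h, hzero⟩
    · exact ⟨-g, by simpa using h, fun x hx hxw => by simp [hzero x hx hxw]⟩
  clear hg hgw g
  obtain ⟨g, hgw, hg⟩ := key
  have hle : ∀ x ∈ V, g x ≤ g v := by
    intro x hx
    by_contra! hlt
    obtain ⟨y, hy, hlt'⟩ := exists_adj_lt hV hv g hx hlt
    by_cases hyw : y = w
    · subst hyw; linarith
    · rw [hg y hy hyw] at hlt'; exact lt_irrefl _ hlt'
  set F := V.filter fun x => g x = g v with hF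
  have hface : IsFace V F := ⟨Finset.filter_subset _ _, g, g v,
    fun x hx => (Finset.mem_filter.1 hx).2,
    fun x hx hn => lt_of_le_of_ne (hle x hx) fun h => hn (Finset.mem_filter.2 ⟨hx, h⟩)⟩
  have hvF : v ∈ F := Finset.mem_filter.2 ⟨hv, rfl⟩
  have hwF : w ∉ F := fun h => hgw.ne (Finset.mem_filter.1 h).2
  have hnF : ∀ x, Adj V v x → x ≠ w → x ∈ F := fun x hx hxw =>
    Finset.mem_filter.2 ⟨hx.right_mem, hg x hx hxw⟩
  refine ⟨F, hface, le_antisymm (hface.dim_lt (fun h => hwF (h ▸ hvw.right_mem)) hvF) ?_,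
    hvF, hwF, hnF⟩
  refine dim_le_succ (hspan.trans (sup_le_sup_right ?_ _))
  rw [Submodule.span_le, hN, Finset.coe_image]
  rintro _ ⟨y, hy, rfl⟩
  rw [Finset.mem_coe, Finset.mem_erase, mem_nbrs] at hy
  exact sub_mem_span (hnF y hy.2 hy.1) hvF

lemma exists_linear_relation {n : ℕ} (a : Fin n → E) (hV : dim V < n)
    (ha : ∀ i, a i ∈ vectorSpan ℝ (V : Set E)) :
    ∃ g : Fin n → ℝ, ∑ i, g i • a i = 0 ∧ ∃ i, g i ≠ 0 := by
  rw [← Fintype.not_linearIndependent_iff]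
  intro h
  have h1 := finrank_span_eq_card h
  have h2 := Submodule.finrank_mono (R := ℝ)
    (Submodule.span_le.2 (Set.range_subset_iff.2 ha))
  rw [h1, Fintype.card_fin] at h2
  unfold dim at hV
  omega

/-- A point set in convex position of dimension at most one has at most two points. -/
lemma card_le_two (hV : ConvexPosition V) (hdim : dim V ≤ 1) : V.card ≤ 2 := by
  by_contra! h
  obtain ⟨x, hx, y, hy, z, hz, hxy, hxz, hyz⟩ := Finset.two_lt_card.1 h
  obtain ⟨c, hc, hc0⟩ := exists_linear_relation (V := V) ![y - x, z - x] (by omega) (by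
    intro i
    fin_cases i
    · exact sub_mem_span hy hx
    · exact sub_mem_span hz hx)
  have hlin : ∀ g : E →ₗ[ℝ] ℝ, c 0 * (g y - g x) + c 1 * (g z - g x) = 0 := fun g => by
    have := congrArg g hc
    simpa [Fin.sum_univ_two] using this
  have hexp : ∀ p ∈ V, ∃ g : E →ₗ[ℝ] ℝ, ∀ q ∈ V, q ≠ p → g q < g p := fun p hp => by
    obtain ⟨-, g, e, hg, hg'⟩ := hV p hp
    refine ⟨g, fun q hq hqp => ?_⟩
    rw [hg p (by simp)]
    exact hg' q hq (by simpa using hqp)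
  obtain ⟨f, hf⟩ := hexp x hx
  obtain ⟨g, hg⟩ := hexp y hy
  obtain ⟨k, hk⟩ := hexp z hz
  have f1 := hf y hy hxy.symm
  have f2 := hf z hz hxz.symm
  have g1 := hg x hx hxy
  have g2 := hg z hz hyz.symm
  have k1 := hk x hx hxz
  have k2 := hk y hy hyz
  have ef := hlin f
  have eg := hlin g
  have ek := hlin k
  have c0 : c 0 ≠ 0 ∧ c 1 ≠ 0 := by
    constructor
    · intro h0
      rw [h0, zero_mul, zero_add] at ef
      have h1 : c 1 = 0 := (mul_eq_zero.1 ef).resolve_right (by linarith)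
      obtain ⟨i, hi⟩ := hc0
      fin_cases i <;> simp_all
    · intro h1
      rw [h1, zero_mul, add_zero] at ef
      have h0 : c 0 = 0 := (mul_eq_zero.1 ef).resolve_right (by linarith)
      obtain ⟨i, hi⟩ := hc0
      fin_cases i <;> simp_all
  rcases lt_or_gt_of_ne c0.1 with h0 | h0 <;> rcases lt_or_gt_of_ne c0.2 with h1 | h1
  · nlinarith
  · rcases le_or_gt 0 (c 0 + c 1) with hs | hs
    · nlinarith
    · nlinarith
  · rcases le_or_gt 0 (c 0 + c 1) with hs | hs
    · nlinarith
    · nlinarith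
  · nlinarith

/-- A vertex of a polygon does not have three neighbours. -/
lemma not_three_adj (hdim : dim V ≤ 2) {a b c : E} (ha : Adj V v a)
    (hb : Adj V v b) (hc : Adj V v c) (hab : a ≠ b) (hac : a ≠ c) (hbc : b ≠ c) : False := by
  have hv := ha.left_mem
  obtain ⟨l, hl, hl0⟩ := exists_linear_relation (V := V) ![a - v, b - v, c - v] (by omega) (by
    intro i
    fin_cases i
    · exact sub_mem_span ha.right_mem hv
    · exact sub_mem_span hb.right_mem hv
    · exact sub_mem_span hc.right_mem hv)
  have hlin : ∀ g : E →ₗ[ℝ] ℝ, l 0 * (g a - g v) + l 1 * (g b - g v) + l 2 * (g c - g v) = 0 :=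
    fun g => by
      have := congrArg g hl
      simpa [Fin.sum_univ_three] using this
  have hexp : ∀ p, Adj V v p → ∃ g : E →ₗ[ℝ] ℝ, g p = g v ∧ ∀ q ∈ V, q ≠ v → q ≠ p → g q < g v :=
    fun p hp => by
      obtain ⟨-, -, g, e, hg, hg'⟩ := hp
      refine ⟨g, by rw [hg p (by simp), hg v (by simp)], fun q hq hqv hqp => ?_⟩
      rw [hg v (by simp)]
      exact hg' q hq (by simp [hqv, hqp])
  obtain ⟨f, f0, hf⟩ := hexp a ha
  obtain ⟨g, g0, hg⟩ := hexp b hb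
  obtain ⟨k, k0, hk⟩ := hexp c hc
  have f1 := hf b hb.right_mem hb.1.symm hab.symm
  have f2 := hf c hc.right_mem hc.1.symm hac.symm
  have g1 := hg a ha.right_mem ha.1.symm hab
  have g2 := hg c hc.right_mem hc.1.symm hbc.symm
  have k1 := hk a ha.right_mem ha.1.symm hac
  have k2 := hk b hb.right_mem hb.1.symm hbc
  have ef := hlin f
  have eg := hlin g
  have ek := hlin k
  rw [f0, sub_self, mul_zero, zero_add] at ef
  rw [g0, sub_self, mul_zero, add_zero] at eg
  rw [k0, sub_self, mul_zero, add_zero] at ek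
  have hsign : ∀ {p q x y : ℝ}, x < 0 → y < 0 → p * x + q * y = 0 → (0 < p → q < 0) ∧
      (p < 0 → 0 < q) ∧ (p = 0 → q = 0) := by
    intro p q x y hx hy h
    refine ⟨fun hp => ?_, fun hp => ?_, fun hp => ?_⟩
    · by_contra! hq; nlinarith
    · by_contra! hq; nlinarith
    · subst hp
      rw [zero_mul, zero_add] at h
      exact (mul_eq_zero.1 h).resolve_right hy.ne
  have s1 := hsign (sub_neg.2 f1) (sub_neg.2 f2) ef
  have s2 := hsign (sub_neg.2 g1) (sub_neg.2 g2) eg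
  have s3 := hsign (sub_neg.2 k1) (sub_neg.2 k2) ek
  rcases lt_trichotomy (l 0) 0 with h | h | h
  · linarith [s1.1 (s3.2.1 h), s2.2.1 h]
  · have h1 := s3.2.2 h
    have h2 := s2.2.2 h
    obtain ⟨i, hi⟩ := hl0
    fin_cases i <;> simp_all
  · linarith [s1.2.1 (s3.1 h), s2.1 h]

end Dimension

section LowerBound

variable {E : Type*} [AddCommGroup E] [Module ℝ E] {V F : Finset E} {u v w : E}

lemma card_nbrs_add_one_of_isFace_erase (hV : ConvexPosition V) (hF : IsFace V (V.erase w))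
    (hw : w ∈ V) : deg V w + 1 = V.card := by
  have : nbrs V w = V.erase w := by
    ext u
    rw [mem_nbrs, Finset.mem_erase]
    exact ⟨fun h => ⟨h.1.symm, h.right_mem⟩,
      fun h => (adj_of_isFace_erase hV hF hw h.2 h.1).symm⟩
  rw [deg, this, Finset.card_erase_add_one hw]

lemma exists_eq_erase {α : Type*} {V F : Finset α} (hFV : F ⊆ V) (h : (V \ F).card = 1) :
    ∃ w ∈ V, F = V.erase w := by
  obtain ⟨w, hw⟩ := Finset.card_eq_one.1 h
  have hwV : w ∈ V := (Finset.mem_sdiff.1 (hw ▸ Finset.mem_singleton_self w)).1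
  refine ⟨w, hwV, ?_⟩
  rw [Finset.erase_eq, ← hw, Finset.sdiff_sdiff_eq_self hFV]

/-- A lower bound for the number of edges of a `d`-polytope with `d + 1 + k` vertices. -/
theorem lower_bound_degSum (hV : ConvexPosition V) {d k : ℕ} (hdim : dim V = d)
    (hcard : V.card = d + 1 + k) : d * (d + 1) + k * (2 * d) ≤ degSum V + k * (k + 1) := by
  induction d generalizing V k with
  | zero => simp
  | succ d ih =>
    obtain ⟨F, hF, ⟨p, hp⟩, hFd⟩ := exists_facet hV (by omega)
    have hFd' : dim F = d := by omega
    have h1 := dim_lt_card hp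
    obtain ⟨j, hj⟩ : ∃ j, F.card = d + 1 + j := ⟨F.card - (d + 1), by omega⟩
    have hle := ih (hV.mono hF.1) hFd' hj
    have hm := Finset.card_sdiff_add_card_eq_card hF.1
    have hdeg : ∀ s ∈ V \ F, d + 1 ≤ deg V s := fun s hs => by
      rw [← hdim]; exact dim_le_deg hV (Finset.mem_sdiff.1 hs).1
    have hne : F ≠ V := by rintro rfl; omega
    have hmpos : 0 < (V \ F).card := Finset.card_pos.2 (Finset.sdiff_nonempty.2 fun h =>
      hne (Finset.Subset.antisymm hF.1 h))
    obtain ⟨m, hm'⟩ : ∃ m, (V \ F).card = m + 1 := ⟨(V \ F).card - 1, by omega⟩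
    have hk : k = j + m := by omega
    subst hk
    rcases Nat.eq_zero_or_pos m with rfl | hmpos
    · obtain ⟨w, hw, rfl⟩ := exists_eq_erase hF.1 hm'
      have hdw := card_nbrs_add_one_of_isFace_erase hV hF hw
      have := hF.le_degSum (d := d + 1 + j) (L := degSum (V.erase w)) (m := 1) (fun s hs => by
        have : s = w := by
          by_contra h
          rw [Finset.mem_sdiff] at hs
          exact hs.2 (Finset.mem_erase.2 ⟨h, hs.1⟩)
        subst this; omega) le_rfl hm'
      nlinarith
    · have := hF.le_degSum hdeg le_rfl hm'
      obtain ⟨i, rfl⟩ : ∃ i, m = i + 1 := ⟨m - 1, by omega⟩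
      nlinarith [Nat.zero_le (j * i)]

end LowerBound

section Counterexample

variable {E : Type*} [AddCommGroup E] [Module ℝ E] {V F G : Finset E} {u v w : E}

/-- The vertices of a hypothetical `6`-polytope with `12` vertices and `39` edges. -/
structure IsCounterexample (V : Finset E) : Prop where
  convexPosition : ConvexPosition V
  dim_eq : dim V = 6
  card_eq : V.card = 12
  degSum_eq : degSum V = 78

lemma nonempty_of_dim_pos (h : 0 < dim F) : F.Nonempty := by
  by_contra hn
  rw [Finset.not_nonempty_iff_eq_empty] at hn
  rw [hn, dim, Finset.coe_empty, vectorSpan_empty, finrank_bot] at h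
  exact h.false

lemma IsFace.eq_of_subset (hG : IsFace V G) (hF : IsFace V F) (h : F ⊆ G) (hv : v ∈ F)
    (hdim : dim G ≤ dim F) : F = G := by
  by_contra hne
  exact absurd ((hF.restrict h hG.1).dim_lt hne hv) (by omega)

namespace IsCounterexample

lemma six_le_deg (H : IsCounterexample V) (hv : v ∈ V) : 6 ≤ deg V v :=
  H.dim_eq ▸ dim_le_deg H.convexPosition hv

lemma card_sdiff (H : IsCounterexample V) (hF : IsFace V F) : (V \ F).card + F.card = 12 := by
  rw [Finset.card_sdiff_add_card_eq_card hF.1, H.card_eq]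

lemma facet_ne (H : IsCounterexample V) (hd : dim F = 5) : F ≠ V := by
  rintro rfl
  exact absurd H.dim_eq (by omega)

lemma facet_card (H : IsCounterexample V) (hF : IsFace V F) (hd : dim F = 5) :
    6 ≤ F.card ∧ F.card ≤ 11 ∧ F.card ≠ 8 := by
  obtain ⟨p, hp⟩ := nonempty_of_dim_pos (show 0 < dim F by omega)
  have h1 := dim_lt_card hp
  have h2 := Finset.card_lt_card (Finset.ssubset_iff_subset_ne.2 ⟨hF.1, H.facet_ne hd⟩)
  have h3 := H.card_eq
  refine ⟨by omega, by omega, fun h => ?_⟩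
  have h4 := lower_bound_degSum (k := 2) (H.convexPosition.mono hF.1) hd h
  have h5 := hF.le_degSum (d := 6) (m := 4)
    (fun s hs => H.six_le_deg (Finset.mem_sdiff.1 hs).1) le_rfl (by have := H.card_sdiff hF; omega)
  rw [H.degSum_eq] at h5
  omega

lemma facet_card_seven (H : IsCounterexample V)
    (hF : IsFace V F) (hd : dim F = 5) (hc : F.card = 7) :
    degSum F = 38 ∧ (∀ s ∈ V \ F, deg V s = 6) ∧
      ∀ s ∈ V \ F, ∀ r ∈ V \ F, s ≠ r → Adj V s r := by
  have h4 := lower_bound_degSum (k := 1) (H.convexPosition.mono hF.1) hd hc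
  exact hF.eq_of_degSum_le (L := 38) (m := 5)
    (fun s hs => H.six_le_deg (Finset.mem_sdiff.1 hs).1) (by omega)
    (by have := H.card_sdiff hF; omega) (by rw [H.degSum_eq])

lemma card_nbrs_inter_facet (H : IsCounterexample V)
    (hF : IsFace V F) (hd : dim F = 5) (hc : F.card = 7)
    (hv : v ∈ V \ F) : (nbrs V v ∩ F).card = 2 := by
  obtain ⟨-, hdeg, hadj⟩ := H.facet_card_seven hF hd hc
  have h1 : nbrs V v \ F = (V \ F).erase v := by
    ext x
    rw [Finset.mem_sdiff, mem_nbrs, Finset.mem_erase]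
    refine ⟨fun h => ⟨h.1.1.symm, Finset.mem_sdiff.2 ⟨h.1.right_mem, h.2⟩⟩,
      fun h => ⟨hadj v hv x h.2 h.1.symm, (Finset.mem_sdiff.1 h.2).2⟩⟩
  have h2 := Finset.card_inter_add_card_sdiff (nbrs V v) F
  have h3 := Finset.card_erase_add_one hv
  have h4 := hdeg v hv
  have h5 := H.card_sdiff hF
  rw [deg] at h4
  rw [h1] at h2
  omega

lemma card_nbrs_inter_inter (H : IsCounterexample V)
    (hF : IsFace V F) (hd : dim F = 5) (hc : F.card = 7)
    (hG : IsFace V G) (hGd : dim G = 5) (hSG : V \ F ⊆ G) (hv : v ∈ V \ F) :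
    (nbrs V v ∩ F ∩ G).card = 1 := by
  have h2 := H.card_nbrs_inter_facet hF hd hc hv
  have hdeg := (H.facet_card_seven hF hd hc).2.1 v hv
  refine le_antisymm ?_ ?_
  · by_contra! h
    have heq : nbrs V v ∩ F ∩ G = nbrs V v ∩ F :=
      Finset.eq_of_subset_of_card_le Finset.inter_subset_left (by omega)
    refine H.facet_ne hGd (Finset.Subset.antisymm hG.1 ?_)
    refine (isFace_self V).subset_of_nbrs H.convexPosition hG (Finset.mem_sdiff.1 hv).1 (hSG hv) ?_
    intro w hw hvw
    by_cases hwF : w ∈ F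
    · have : w ∈ nbrs V v ∩ F ∩ G := by
        rw [heq]; exact Finset.mem_inter.2 ⟨mem_nbrs.2 hvw, hwF⟩
      exact (Finset.mem_inter.1 this).2
    · exact hSG (Finset.mem_sdiff.2 ⟨hw, hwF⟩)
  · have h3 := dim_le_deg (H.convexPosition.mono hG.1) (hSG hv)
    rw [hGd, deg, hG.nbrs_eq (hSG hv)] at h3
    have h4 := Finset.card_inter_add_card_sdiff (nbrs V v) F
    have h5 := Finset.card_inter_add_card_sdiff (nbrs V v ∩ G) F
    have h6 : (nbrs V v ∩ G) \ F ⊆ nbrs V v \ F :=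
      Finset.sdiff_subset_sdiff Finset.inter_subset_left le_rfl
    have h7 := Finset.card_le_card h6
    rw [deg] at hdeg
    rw [Finset.inter_right_comm] at h5
    omega

lemma disjoint_nbrs (H : IsCounterexample V)
    (hF : IsFace V F) (hd : dim F = 5) (hc : F.card = 7) {G₁ G₂ : Finset E}
    (hG₁ : IsFace V G₁) (hd₁ : dim G₁ = 5) (hS₁ : V \ F ⊆ G₁)
    (hG₂ : IsFace V G₂) (hd₂ : dim G₂ = 5) (hS₂ : V \ F ⊆ G₂) (hne : G₁ ≠ G₂)
    (hv : v ∈ V \ F) (hvw : Adj V v w) (hwF : w ∈ F) (hw₁ : w ∈ G₁) : w ∉ G₂ := by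
  intro hw₂
  refine hne (hG₂.eq_of_subset hG₁ ?_ (hS₁ hv) (by omega))
  refine hG₁.subset_of_nbrs H.convexPosition hG₂ (hS₁ hv) (hS₂ hv) fun x hx hvx => ?_
  by_cases hxF : x ∈ F
  · have h1 := Finset.card_le_one.1 (H.card_nbrs_inter_inter hF hd hc hG₁ hd₁ hS₁ hv).le
    rw [h1 x (by simp [mem_nbrs, *]) w (by simp [mem_nbrs, *])]
    exact hw₂
  · exact hS₂ (Finset.mem_sdiff.2 ⟨hG₁.1 hx, hxF⟩)

lemma inter_inter_eq_empty (H : IsCounterexample V)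
    (hF : IsFace V F) (hd : dim F = 5) (hc : F.card = 7)
    {G₁ G₂ : Finset E} (hG₁ : IsFace V G₁) (hd₁ : dim G₁ = 5) (hS₁ : V \ F ⊆ G₁)
    (hG₂ : IsFace V G₂) (hd₂ : dim G₂ = 5) (hS₂ : V \ F ⊆ G₂) (hne : G₁ ≠ G₂)
    (hw : w ∈ F) (hw₁ : w ∈ G₁) : w ∉ G₂ := by
  intro hw₂
  have hK := hG₁.inter hG₂
  obtain ⟨-, f, c, hf, hf'⟩ := id hF
  have hcard := H.card_sdiff hF
  obtain ⟨s, hs, hmax⟩ := Finset.exists_max_image (V \ F) f (Finset.card_pos.1 (by omega))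
  obtain ⟨x, hx, hlt⟩ := exists_adj_lt (H.convexPosition.mono hK.1)
    (Finset.mem_inter.2 ⟨hS₁ hs, hS₂ hs⟩) f (Finset.mem_inter.2 ⟨hw₁, hw₂⟩) (by
      rw [hf w hw]
      exact hf' s (Finset.mem_sdiff.1 hs).1 (Finset.mem_sdiff.1 hs).2)
  rw [hK.adj_iff, Finset.mem_inter, Finset.mem_inter] at hx
  by_cases hxF : x ∈ F
  · exact H.disjoint_nbrs hF hd hc hG₁ hd₁ hS₁ hG₂ hd₂ hS₂ hne hs hx.1 hxF hx.2.2.1 hx.2.2.2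
  · exact absurd (hmax x (Finset.mem_sdiff.2 ⟨hx.1.right_mem, hxF⟩)) (not_le.2 hlt)

lemma card_inter_le_five (H : IsCounterexample V)
    (hF : IsFace V F) (hd : dim F = 5) (hc : F.card = 7)
    (hG : IsFace V G) (hGd : dim G = 5) (hSG : V \ F ⊆ G) : (F ∩ G).card ≤ 5 := by
  have hsub : F ∩ G ⊆ (V \ F).biUnion fun s => nbrs V s ∩ F ∩ G := by
    intro x hx
    obtain ⟨hxF, hxG⟩ := Finset.mem_inter.1 hx
    obtain ⟨w, hw, hwF, hxw⟩ := hF.exists_adj_notMem H.convexPosition (H.facet_ne hd) hxF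
    refine Finset.mem_biUnion.2 ⟨w, Finset.mem_sdiff.2 ⟨hw, hwF⟩, ?_⟩
    simp [mem_nbrs, hxw.symm, hxF, hxG]
  have h1 := Finset.card_le_card hsub
  have h2 := Finset.card_biUnion_le_card_mul (V \ F) (fun s => nbrs V s ∩ F ∩ G) 1
    fun s hs => (H.card_nbrs_inter_inter hF hd hc hG hGd hSG hs).le
  have := H.card_sdiff hF
  omega

lemma subset_union (H : IsCounterexample V)
    (hF : IsFace V F) (hd : dim F = 5) (hc : F.card = 7) {G₁ G₂ : Finset E}
    (hG₁ : IsFace V G₁) (hd₁ : dim G₁ = 5) (hS₁ : V \ F ⊆ G₁)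
    (hG₂ : IsFace V G₂) (hd₂ : dim G₂ = 5) (hS₂ : V \ F ⊆ G₂) (hne : G₁ ≠ G₂) :
    F ⊆ G₁ ∪ G₂ := by
  intro x hx
  obtain ⟨s, hs, hsF, hxs⟩ := hF.exists_adj_notMem H.convexPosition (H.facet_ne hd) hx
  have hs' := Finset.mem_sdiff.2 ⟨hs, hsF⟩
  have h1 := H.card_nbrs_inter_inter hF hd hc hG₁ hd₁ hS₁ hs'
  have h2 := H.card_nbrs_inter_inter hF hd hc hG₂ hd₂ hS₂ hs'
  have h3 := H.card_nbrs_inter_facet hF hd hc hs'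
  have hdisj : Disjoint (nbrs V s ∩ F ∩ G₁) (nbrs V s ∩ F ∩ G₂) := by
    rw [Finset.disjoint_left]
    intro y hy hy'
    simp only [Finset.mem_inter, mem_nbrs] at hy hy'
    exact H.inter_inter_eq_empty hF hd hc hG₁ hd₁ hS₁ hG₂ hd₂ hS₂ hne hy.1.2 hy.2 hy'.2
  have heq : (nbrs V s ∩ F ∩ G₁) ∪ (nbrs V s ∩ F ∩ G₂) = nbrs V s ∩ F :=
    Finset.eq_of_subset_of_card_le (Finset.union_subset Finset.inter_subset_left
      Finset.inter_subset_left) (by rw [Finset.card_union_of_disjoint hdisj]; omega)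
  have hxm : x ∈ nbrs V s ∩ F := Finset.mem_inter.2 ⟨mem_nbrs.2 hxs.symm, hx⟩
  rw [← heq, ← Finset.inter_union_distrib_left] at hxm
  exact (Finset.mem_inter.1 hxm).2

/-- The case in which one of the two facets has exactly two vertices in `F`. -/
lemma false_of_card_inter_eq_two (H : IsCounterexample V)
    (hF : IsFace V F) (hd : dim F = 5) (hc : F.card = 7)
    (hG : IsFace V G) (hGd : dim G = 5) (hSG : V \ F ⊆ G) (h2 : (F ∩ G).card = 2) : False := by
  have hsum := (H.facet_card_seven hF hd hc).1
  have hGc : G.card = 7 := by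
    have h1 := Finset.card_inter_add_card_sdiff G F
    have h3 : G \ F = V \ F := Finset.Subset.antisymm (Finset.sdiff_subset_sdiff hG.1 le_rfl)
      fun x hx => Finset.mem_sdiff.2 ⟨hSG hx, (Finset.mem_sdiff.1 hx).2⟩
    have := H.card_sdiff hF
    rw [Finset.inter_comm, h3] at h1
    omega
  have hdeg := (H.facet_card_seven hG hGd hGc).2.1
  have hFG := Finset.card_inter_add_card_sdiff F G
  have hA : ∑ x ∈ F ∩ G, deg F x ≤ ∑ _x ∈ F ∩ G, 6 := Finset.sum_le_sum fun x hx => by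
    have hxF := (Finset.mem_inter.1 hx).1
    have := card_nbrs_inter_lt (V := V) hxF
    rw [← hF.nbrs_eq hxF, ← deg] at this
    omega
  have hB : ∑ x ∈ F \ G, deg F x ≤ ∑ _x ∈ F \ G, 5 := Finset.sum_le_sum fun x hx => by
    obtain ⟨hxF, hxG⟩ := Finset.mem_sdiff.1 hx
    have h6 := hdeg x (Finset.mem_sdiff.2 ⟨hF.1 hxF, hxG⟩)
    obtain ⟨w, -, hwF, hxw⟩ := hF.exists_adj_notMem H.convexPosition (H.facet_ne hd) hxF
    have : nbrs F x ⊆ (nbrs V x).erase w := by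
      rw [hF.nbrs_eq hxF]
      intro y hy
      rw [Finset.mem_inter] at hy
      exact Finset.mem_erase.2 ⟨fun h => hwF (h ▸ hy.2), hy.1⟩
    have := Finset.card_le_card this
    have h8 := Finset.card_erase_add_one (mem_nbrs.2 hxw)
    rw [deg] at h6 ⊢
    omega
  have htot : degSum F = ∑ x ∈ F ∩ G, deg F x + ∑ x ∈ F \ G, deg F x :=
    (Finset.sum_inter_add_sum_sdiff F G _).symm
  rw [Finset.sum_const, smul_eq_mul] at hA hB
  omega

lemma facet_card_ne_seven (H : IsCounterexample V)
    (hF : IsFace V F) (hd : dim F = 5) : F.card ≠ 7 := by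
  intro hc
  obtain ⟨-, hdeg, hadj⟩ := H.facet_card_seven hF hd hc
  have hcard := H.card_sdiff hF
  obtain ⟨s, hs⟩ := Finset.card_pos.1 (show 0 < (V \ F).card by omega)
  obtain ⟨x, y, hxy, hxy'⟩ := Finset.card_eq_two.1 (H.card_nbrs_inter_facet hF hd hc hs)
  have hfacet : ∀ z ∈ nbrs V s ∩ F, ∃ G, IsFace V G ∧ dim G = 5 ∧ V \ F ⊆ G ∧ z ∉ G ∧
      ∀ t ∈ nbrs V s, t ≠ z → t ∈ G := by
    intro z hz
    rw [Finset.mem_inter, mem_nbrs] at hz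
    obtain ⟨G, hG, hGd, hsG, hzG, hnG⟩ := exists_facet_of_simple H.convexPosition
      ((hdeg s hs).trans H.dim_eq.symm) hz.1
    refine ⟨G, hG, by have := H.dim_eq; omega, ?_, hzG, fun t ht => hnG t (mem_nbrs.1 ht)⟩
    intro t ht
    by_cases hts : s = t
    · exact hts ▸ hsG
    · exact hnG t (hadj s hs t ht hts) fun h => (Finset.mem_sdiff.1 ht).2 (h ▸ hz.2)
  have hx : x ∈ nbrs V s ∩ F := by simp [hxy']
  have hy : y ∈ nbrs V s ∩ F := by simp [hxy']
  obtain ⟨G₁, hG₁, hd₁, hS₁, hx₁, hn₁⟩ := hfacet x hx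
  obtain ⟨G₂, hG₂, hd₂, hS₂, hx₂, hn₂⟩ := hfacet y hy
  have hne : G₁ ≠ G₂ := by
    rintro rfl
    exact hx₂ (hn₁ y (Finset.mem_inter.1 hy).1 hxy.symm)
  have hGcard : ∀ G, IsFace V G → V \ F ⊆ G → G.card = (F ∩ G).card + 5 := by
    intro G hG hSG
    have h1 := Finset.card_inter_add_card_sdiff G F
    have h3 : G \ F = V \ F := Finset.Subset.antisymm (Finset.sdiff_subset_sdiff hG.1 le_rfl)
      fun x hx => Finset.mem_sdiff.2 ⟨hSG hx, (Finset.mem_sdiff.1 hx).2⟩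
    rw [Finset.inter_comm, h3] at h1
    omega
  have hunion : (F ∩ G₁) ∪ (F ∩ G₂) = F := by
    rw [← Finset.inter_union_distrib_left, Finset.inter_eq_left]
    exact H.subset_union hF hd hc hG₁ hd₁ hS₁ hG₂ hd₂ hS₂ hne
  have hdisj : Disjoint (F ∩ G₁) (F ∩ G₂) := by
    rw [Finset.disjoint_left]
    intro z hz hz'
    rw [Finset.mem_inter] at hz hz'
    exact H.inter_inter_eq_empty hF hd hc hG₁ hd₁ hS₁ hG₂ hd₂ hS₂ hne hz.1 hz.2 hz'.2
  have hsum := Finset.card_union_of_disjoint hdisj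
  rw [hunion, hc] at hsum
  have e1 := hGcard G₁ hG₁ hS₁
  have e2 := hGcard G₂ hG₂ hS₂
  have l1 := H.card_inter_le_five hF hd hc hG₁ hd₁ hS₁
  have l2 := H.card_inter_le_five hF hd hc hG₂ hd₂ hS₂
  have c1 := H.facet_card hG₁ hd₁
  have c2 := H.facet_card hG₂ hd₂
  have n1 : (F ∩ G₁).card ≠ 2 := H.false_of_card_inter_eq_two hF hd hc hG₁ hd₁ hS₁
  have n2 : (F ∩ G₂).card ≠ 2 := H.false_of_card_inter_eq_two hF hd hc hG₂ hd₂ hS₂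
  omega

end IsCounterexample

end Counterexample

section NineVertices

variable {E : Type*} [AddCommGroup E] [Module ℝ E] {V F G R : Finset E} {u v w : E}

/-- In a `5`-polytope with `9` vertices and `24` edges, some facet omits neither exactly one vertex
nor exactly two vertices that are simple and adjacent. -/
lemma false_of_facets (hF : ConvexPosition F) (hd : dim F = 5) (hc : F.card = 9)
    (hs : degSum F = 48) (h : ∀ R, IsFace F R → dim R = 4 → (F \ R).card = 1 ∨
      (F \ R).card = 2 ∧ (∀ s ∈ F \ R, deg F s = 5) ∧
        ∀ s ∈ F \ R, ∀ r ∈ F \ R, s ≠ r → Adj F s r) : False := by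
  have hdeg : ∀ v ∈ F, 5 ≤ deg F v := fun v hv => hd ▸ dim_le_deg hF hv
  have hlarge : (F.filter fun v => 6 ≤ deg F v).card + 45 ≤ 48 := by
    have h1 : ∑ v ∈ F, ((if 6 ≤ deg F v then 1 else 0) + 5) ≤ degSum F :=
      Finset.sum_le_sum fun v hv => by
        have := hdeg v hv
        split_ifs <;> omega
    rw [Finset.sum_add_distrib, ← Finset.card_filter, Finset.sum_const, hc, hs] at h1
    exact h1
  obtain ⟨w, hw, hw6⟩ : ∃ w ∈ F, 6 ≤ deg F w := by
    by_contra! hn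
    have : degSum F ≤ ∑ _v ∈ F, 5 := Finset.sum_le_sum fun v hv => by have := hn v hv; omega
    rw [Finset.sum_const, hc, hs] at this
    norm_num at this
  obtain ⟨v, hwv, hv5⟩ : ∃ v, Adj F w v ∧ deg F v = 5 := by
    by_contra! hn
    have hsub : insert w (nbrs F w) ⊆ F.filter fun v => 6 ≤ deg F v := by
      refine Finset.insert_subset (Finset.mem_filter.2 ⟨hw, hw6⟩) fun v hv => ?_
      have hv' := mem_nbrs.1 hv
      have h1 := hdeg v hv'.right_mem
      have h2 := hn v hv'
      exact Finset.mem_filter.2 ⟨hv'.right_mem, by omega⟩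
    have h1 := Finset.card_le_card hsub
    rw [Finset.card_insert_of_notMem fun hm => (mem_nbrs.1 hm).1 rfl, ← deg] at h1
    omega
  have hpyr : ∀ R z, IsFace F R → (F \ R).card = 1 → z ∈ F → z ∉ R → deg F z = 8 := by
    intro R z hR h1 hz hzR
    obtain ⟨x, hx, rfl⟩ := exists_eq_erase hR.1 h1
    obtain rfl : z = x := by
      by_contra hne
      exact hzR (Finset.mem_erase.2 ⟨hne, hz⟩)
    have := card_nbrs_add_one_of_isFace_erase hF hR hx
    omega
  have hfacet : ∀ {x y}, Adj F x y → deg F x = 5 →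
      ∃ R, IsFace F R ∧ dim R = 4 ∧ x ∈ R ∧ y ∉ R := by
    intro x y hxy hx
    obtain ⟨R, hR, hRd, hxR, hyR, -⟩ := exists_facet_of_simple hF (hx.trans hd.symm) hxy
    exact ⟨R, hR, by omega, hxR, hyR⟩
  have hw8 : deg F w = 8 := by
    obtain ⟨R, hR, hRd, -, hwR⟩ := hfacet hwv.symm hv5
    rcases h R hR hRd with h1 | ⟨-, h2, -⟩
    · exact hpyr R w hR h1 hw hwR
    · have := h2 w (Finset.mem_sdiff.2 ⟨hw, hwR⟩)
      omega
  have hsimple : ∀ p ∈ F, p ≠ w → deg F p = 5 := by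
    intro p hp hpw
    by_contra hne
    have h1 : ∑ _x ∈ F.erase w, 5 < ∑ x ∈ F.erase w, deg F x :=
      Finset.sum_lt_sum (fun x hx => hdeg x (Finset.mem_of_mem_erase hx))
        ⟨p, Finset.mem_erase.2 ⟨hpw, hp⟩, lt_of_le_of_ne (hdeg p hp) (Ne.symm hne)⟩
    have h2 := Finset.add_sum_erase F (deg F) hw
    rw [← degSum, hs] at h2
    rw [Finset.sum_const, Finset.card_erase_of_mem hw, hc, smul_eq_mul] at h1
    omega
  have hfacet' : ∀ {x y}, Adj F x y → x ≠ w → y ≠ w → ∃ R z, IsFace F R ∧ x ∈ R ∧ y ∉ R ∧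
      F \ R = {y, z} ∧ y ≠ z ∧ z ≠ w ∧ Adj F y z := by
    intro x y hxy hxw hyw
    have hy := hxy.right_mem
    obtain ⟨R, hR, hRd, hxR, hyR⟩ := hfacet hxy (hsimple x hxy.left_mem hxw)
    have hyFR := Finset.mem_sdiff.2 ⟨hy, hyR⟩
    rcases h R hR hRd with h1 | ⟨h2, h3, h4⟩
    · have h5 := hpyr R y hR h1 hy hyR
      rw [hsimple y hy hyw] at h5
      omega
    · have h5 := Finset.card_erase_add_one hyFR
      obtain ⟨z, hz⟩ := Finset.card_eq_one.1 (show ((F \ R).erase y).card = 1 by omega)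
      have hzm : z ∈ (F \ R).erase y := hz ▸ Finset.mem_singleton_self z
      obtain ⟨hzy, hzFR⟩ := Finset.mem_erase.1 hzm
      refine ⟨R, z, hR, hxR, hyR, by rw [← hz, Finset.insert_erase hyFR], hzy.symm, ?_,
        h4 y hyFR z hzFR hzy.symm⟩
      rintro rfl
      have := h3 z hzFR
      omega
  obtain ⟨z₀, hz₀⟩ : ((nbrs F v).erase w).Nonempty := by
    rw [← Finset.card_pos]
    have := Finset.card_erase_add_one (mem_nbrs.2 hwv.symm)
    rw [← deg] at this
    omega
  obtain ⟨hz₀w, hvz₀⟩ := Finset.mem_erase.1 hz₀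
  obtain ⟨T, z, hT, -, hz₀T, hTeq, hz₀z, hzw, hadj⟩ := hfacet' (mem_nbrs.1 hvz₀) hwv.1.symm hz₀w
  obtain ⟨T', r, hT', hz₀T', -, hTeq', hzr, hrw, -⟩ := hfacet' hadj hz₀w hzw
  have hr : r ∈ F \ T' := by simp [hTeq']
  rw [Finset.mem_sdiff] at hr
  have hz : z ∈ F \ T := by simp [hTeq]
  rw [Finset.mem_sdiff] at hz
  have hrT : r ∈ T := by
    by_contra hn
    have : r ∈ F \ T := Finset.mem_sdiff.2 ⟨hr.1, hn⟩
    rw [hTeq, Finset.mem_insert, Finset.mem_singleton] at this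
    rcases this with rfl | rfl
    · exact hr.2 hz₀T'
    · exact hzr rfl
  have herase : T ∩ T' = T.erase r := by
    ext x
    rw [Finset.mem_inter, Finset.mem_erase]
    constructor
    · rintro ⟨hx, hx'⟩
      exact ⟨fun h => hr.2 (h ▸ hx'), hx⟩
    · rintro ⟨hxr, hx⟩
      refine ⟨hx, ?_⟩
      by_contra hn
      have : x ∈ F \ T' := Finset.mem_sdiff.2 ⟨hT.1 hx, hn⟩
      rw [hTeq', Finset.mem_insert, Finset.mem_singleton] at this
      rcases this with rfl | rfl
      · exact hz.2 hx
      · exact hxr rfl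
  have h1 := card_nbrs_add_one_of_isFace_erase (hF.mono hT.1)
    (herase ▸ (hT.inter hT').restrict Finset.inter_subset_left hT.1) hrT
  have h2 := hT.deg_le hrT
  have h3 := hsimple r hr.1 hrw
  have h4 := Finset.card_sdiff_add_card_eq_card hT.1
  rw [hTeq, Finset.card_pair hz₀z] at h4
  omega

namespace IsCounterexample

lemma facet_card_nine (H : IsCounterexample V)
    (hF : IsFace V F) (hd : dim F = 5) (hc : F.card = 9) :
    degSum F = 48 ∧ (∀ s ∈ V \ F, deg V s = 6) ∧
      ∀ s ∈ V \ F, ∀ r ∈ V \ F, s ≠ r → Adj V s r := by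
  have h4 := lower_bound_degSum (k := 3) (H.convexPosition.mono hF.1) hd hc
  exact hF.eq_of_degSum_le (L := 48) (m := 3)
    (fun s hs => H.six_le_deg (Finset.mem_sdiff.1 hs).1) (by omega)
    (by have := H.card_sdiff hF; omega) (by rw [H.degSum_eq])

lemma facet_card_ne_nine (H : IsCounterexample V)
    (hF : IsFace V F) (hd : dim F = 5) : F.card ≠ 9 := by
  intro hc
  obtain ⟨hsum, hdeg, hadj⟩ := H.facet_card_nine hF hd hc
  have hcard := H.card_sdiff hF
  have hFc := H.convexPosition.mono hF.1
  refine false_of_facets hFc hd hc hsum fun R hR hRd => ?_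
  obtain ⟨p, hp⟩ := nonempty_of_dim_pos (show 0 < dim R by omega)
  have hRF : R ≠ F := by
    rintro rfl
    omega
  obtain ⟨G, hG, hGF, s, hsG, hsF⟩ := hF.exists_inter_eq (H.facet_ne hd) hR
  have hRG : R ⊆ G := hGF ▸ Finset.inter_subset_left
  have hs := Finset.mem_sdiff.2 ⟨hG.1 hsG, hsF⟩
  have hGd : dim G = 5 := by
    have h1 := ((hF.trans hR).restrict hRG hG.1).dim_lt (fun h => hsF (hR.1 (h ▸ hsG))) hp
    have h2 := hG.dim_lt (fun h => hRF (by rw [← hGF, h, Finset.inter_eq_right.2 hF.1])) hsG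
    have := H.dim_eq
    omega
  have hGS : 2 ≤ (G \ F).card := by
    have h1 := dim_le_deg (H.convexPosition.mono hG.1) hsG
    rw [hGd, deg, hG.nbrs_eq hsG] at h1
    have h2 := hdeg s hs
    rw [deg] at h2
    have h3 := Finset.card_inter_add_card_sdiff (nbrs V s) G
    have h4 : V \ F ⊆ (G \ F) ∪ (nbrs V s \ G) := by
      intro x hx
      rw [Finset.mem_union, Finset.mem_sdiff, Finset.mem_sdiff, mem_nbrs]
      by_cases hxG : x ∈ G
      · exact Or.inl ⟨hxG, (Finset.mem_sdiff.1 hx).2⟩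
      · exact Or.inr ⟨hadj s hs x hx fun h => hxG (h ▸ hsG), hxG⟩
    have h5 := (Finset.card_le_card h4).trans (Finset.card_union_le _ _)
    omega
  have hGS' : (G \ F).card ≤ 3 := by
    have := Finset.card_le_card (Finset.sdiff_subset_sdiff hG.1 (le_refl F))
    omega
  have h1 := Finset.card_inter_add_card_sdiff G F
  rw [hGF] at h1
  have h2 := H.facet_card hG hGd
  have h3 := H.facet_card_ne_seven hG hGd
  have h4 := dim_lt_card hp
  have h5 := Finset.card_sdiff_add_card_eq_card hR.1
  have h6 := Finset.card_pos.2 (Finset.sdiff_nonempty.2 fun h =>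
    hRF (Finset.Subset.antisymm hR.1 h))
  have hdegF : ∀ s ∈ F \ R, 5 ≤ deg F s := fun s hs =>
    hd ▸ dim_le_deg hFc (Finset.mem_sdiff.1 hs).1
  have hRc : R.card ≠ 6 := fun h => by
    have h7 := lower_bound_degSum (k := 1) (hFc.mono hR.1) hRd h
    have h8 := hR.le_degSum (L := 26) (m := 3) hdegF (by omega) (by omega)
    omega
  by_cases hR7 : R.card = 7
  · right
    have h7 := lower_bound_degSum (k := 2) (hFc.mono hR.1) hRd hR7
    have hm : (F \ R).card = 2 := by omega
    exact ⟨hm, (hR.eq_of_degSum_le (L := 30) hdegF (by omega) hm (by omega)).2⟩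
  · left
    omega

end IsCounterexample

end NineVertices

section Cofacets

variable {E : Type*} [AddCommGroup E] [Module ℝ E] {V F G O : Finset E} {u v w : E}

/-- A set of one or two vertices whose complement is a face. -/
def IsCofacet (V O : Finset E) : Prop :=
  O ⊆ V ∧ IsFace V (V \ O) ∧ O.Nonempty ∧ O.card ≤ 2

namespace IsCounterexample

lemma facet_card_cases (H : IsCounterexample V)
    (hF : IsFace V F) (hd : dim F = 5) : F.card = 6 ∨ 10 ≤ F.card := by
  have h1 := H.facet_card hF hd
  have h2 := H.facet_card_ne_seven hF hd
  have h3 := H.facet_card_ne_nine hF hd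
  omega

lemma eq_of_ten_le_deg (H : IsCounterexample V)
    (hu : u ∈ V) (hv : v ∈ V) (hu' : 10 ≤ deg V u) (hv' : 10 ≤ deg V v) :
    u = v := by
  by_contra hne
  have h1 : ∑ x ∈ V, (6 + ((if x = u then 4 else 0) + if x = v then 4 else 0)) ≤ degSum V :=
    Finset.sum_le_sum fun x hx => by
      have := H.six_le_deg hx
      split_ifs with h1 h2 h2
      · exact absurd (h1.symm.trans h2) hne
      · subst h1; omega
      · subst h2; omega
      · omega
  rw [Finset.sum_add_distrib, Finset.sum_add_distrib, Finset.sum_ite_eq' V u, if_pos hu,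
    Finset.sum_ite_eq' V v, if_pos hv, Finset.sum_const, H.card_eq, H.degSum_eq] at h1
  norm_num at h1

lemma ten_le_deg (H : IsCounterexample V)
    {O O' : Finset E} (hO : IsCofacet V O) (hO' : IsCofacet V O') (hu : u ∈ O)
    (hu' : u ∈ O') (hv : v ∈ O) (hv' : v ∉ O') : 10 ≤ deg V v := by
  have hvA : v ∈ V \ O' := Finset.mem_sdiff.2 ⟨hO.1 hv, hv'⟩
  have huv : u ≠ v := fun h => hv' (h ▸ hu')
  have hOeq : O = {u, v} := (Finset.eq_of_subset_of_card_le
    (Finset.insert_subset hu (Finset.singleton_subset_iff.2 hv))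
    (by rw [Finset.card_pair huv]; exact hO.2.2.2)).symm
  have herase : (V \ O) ∩ (V \ O') = (V \ O').erase v := by
    ext x
    simp only [hOeq, Finset.mem_inter, Finset.mem_sdiff, Finset.mem_insert, Finset.mem_singleton,
      Finset.mem_erase]
    constructor
    · tauto
    · rintro ⟨h1, h2, h3⟩
      exact ⟨⟨h2, fun h => h.elim (fun h => h3 (h ▸ hu')) h1⟩, h2, h3⟩
  have h1 := card_nbrs_add_one_of_isFace_erase (H.convexPosition.mono hO'.2.1.1)
    (herase ▸ (hO.2.1.inter hO'.2.1).restrict Finset.inter_subset_right hO'.2.1.1) hvA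
  have hcard := Finset.card_sdiff_add_card_eq_card hO'.1
  have := hO'.2.2.2
  have := H.card_eq
  have hne : V \ O' ≠ V := fun h => (Finset.mem_sdiff.1 (h.symm ▸ hO.1 hu : u ∈ V \ O')).2 hu'
  obtain ⟨w, -, hwA, hvw⟩ := hO'.2.1.exists_adj_notMem H.convexPosition hne hvA
  have hlt : nbrs (V \ O') v ⊂ nbrs V v := by
    rw [hO'.2.1.nbrs_eq hvA]
    exact Finset.ssubset_iff_of_subset Finset.inter_subset_left |>.2
      ⟨w, mem_nbrs.2 hvw, fun h => hwA (Finset.mem_inter.1 h).2⟩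
  have := Finset.card_lt_card hlt
  rw [deg] at h1 ⊢
  omega

lemma disjoint_of_mem_sdiff (H : IsCounterexample V)
    {O O' : Finset E} (hO : IsCofacet V O) (hO' : IsCofacet V O')
    (hv : v ∈ O) (hv' : v ∉ O') : Disjoint O O' := by
  rw [Finset.disjoint_left]
  intro u hu hu'
  have h1 := H.ten_le_deg hO hO' hu hu' hv hv'
  have huv : u ≠ v := fun h => hv' (h ▸ hu')
  obtain ⟨w, hw, hw10, hwv⟩ : ∃ w ∈ V, 10 ≤ deg V w ∧ w ≠ v := by
    by_cases hex : ∃ w ∈ O', w ∉ O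
    · obtain ⟨w, hw, hwO⟩ := hex
      exact ⟨w, hO'.1 hw, H.ten_le_deg hO' hO hu' hu hw hwO, fun h => hwO (h ▸ hv)⟩
    · push Not at hex
      have hlt : O'.card < O.card :=
        Finset.card_lt_card ((Finset.ssubset_iff_of_subset hex).2 ⟨v, hv, hv'⟩)
      have h2 := hO.2.2.2
      have h3 : O' = V \ (V \ O') := (Finset.sdiff_sdiff_eq_self hO'.1).symm
      have h4 := Finset.card_pos.2 hO'.2.2.1
      obtain ⟨w, hw, heq⟩ := exists_eq_erase hO'.2.1.1 (by rw [← h3]; omega)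
      obtain rfl : u = w := by
        by_contra hne
        have : u ∈ V \ O' := heq ▸ Finset.mem_erase.2 ⟨hne, hO.1 hu⟩
        exact (Finset.mem_sdiff.1 this).2 hu'
      have h5 := card_nbrs_add_one_of_isFace_erase H.convexPosition (heq ▸ hO'.2.1) hw
      rw [H.card_eq] at h5
      exact ⟨u, hw, by omega, huv⟩
  exact hwv (H.eq_of_ten_le_deg hw (hO.1 hv) hw10 h1)

lemma disjoint_of_ne (H : IsCounterexample V)
    {O O' : Finset E} (hO : IsCofacet V O) (hO' : IsCofacet V O')
    (hne : O ≠ O') : Disjoint O O' := by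
  by_cases h : O ⊆ O'
  · obtain ⟨v, hv, hv'⟩ := Finset.exists_of_ssubset (Finset.ssubset_iff_subset_ne.2 ⟨h, hne⟩)
    exact (H.disjoint_of_mem_sdiff hO' hO hv hv').symm
  · obtain ⟨v, hv, hv'⟩ := Finset.not_subset.1 h
    exact H.disjoint_of_mem_sdiff hO hO' hv hv'

/-- At a simple vertex at most one facet is a simplex. -/
lemma false_of_two_simplices (H : IsCounterexample V)
    (hv : deg V v = 6) (hvu : Adj V v u) (hvw : Adj V v w) (huw : u ≠ w)
    (hF : IsFace V F) (hFd : dim F = 5) (hFe : F = (insert v (nbrs V v)).erase u)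
    (hG : IsFace V G) (hGd : dim G = 5) (hGe : G = (insert v (nbrs V v)).erase w) : False := by
  set A := insert v (nbrs V v) with hA
  have hvN : v ∉ nbrs V v := fun h => (mem_nbrs.1 h).1 rfl
  have hAV : A ⊆ V := Finset.insert_subset hvu.left_mem nbrs_subset
  have hAc : A.card = 7 := by rw [hA, Finset.card_insert_of_notMem hvN, ← deg, hv]
  have huA : u ∈ A := Finset.mem_insert_of_mem (mem_nbrs.2 hvu)
  have hwA : w ∈ A := Finset.mem_insert_of_mem (mem_nbrs.2 hvw)
  have key : ∀ {K z}, IsFace V K → dim K = 5 → K = A.erase z → z ∈ A → ∀ x ∈ A, ∀ y ∈ A,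
      x ≠ z → y ≠ z → x ≠ y → Adj V x y := by
    intro K z hK hKd hKe hz x hx y hy hxz hyz hxy
    have hxK : x ∈ K := hKe ▸ Finset.mem_erase.2 ⟨hxz, hx⟩
    have hyK : y ∈ K := hKe ▸ Finset.mem_erase.2 ⟨hyz, hy⟩
    have hKc : K.card = 6 := by rw [hKe, Finset.card_erase_of_mem hz, hAc]
    have h1 := dim_le_deg (H.convexPosition.mono hK.1) hxK
    have h2 : nbrs K x = K.erase x := Finset.eq_of_subset_of_card_le
      (fun t ht => Finset.mem_erase.2 ⟨(mem_nbrs.1 ht).1.symm, nbrs_subset ht⟩)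
      (by rw [Finset.card_erase_of_mem hxK, hKc, ← deg]; omega)
    have h3 : y ∈ nbrs K x := h2 ▸ Finset.mem_erase.2 ⟨hxy.symm, hyK⟩
    exact (hK.adj_iff.1 (mem_nbrs.1 h3)).1
  have hadj : ∀ x ∈ A, ∀ y ∈ A, x ≠ y → (x ≠ u ∧ y ≠ u) ∨ (x ≠ w ∧ y ≠ w) → Adj V x y :=
    fun x hx y hy hxy h => h.elim
      (fun h => key hF hFd hFe huA x hx y hy h.1 h.2 hxy)
      (fun h => key hG hGd hGe hwA x hx y hy h.1 h.2 hxy)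
  have hlow : ∑ x ∈ A, (4 + if x ≠ u ∧ x ≠ w then 1 else 0) + 7 ≤
      ∑ x ∈ A, (nbrs V x ∩ A).card := by
    have h1 : ∑ x ∈ A, ((4 + if x ≠ u ∧ x ≠ w then 1 else 0) + 1) ≤
        ∑ x ∈ A, (nbrs V x ∩ A).card := by
      refine Finset.sum_le_sum fun x hx => ?_
      split_ifs with h
      · have : A.erase x ⊆ nbrs V x ∩ A := fun y hy => by
          obtain ⟨hyx, hyA⟩ := Finset.mem_erase.1 hy
          refine Finset.mem_inter.2 ⟨mem_nbrs.2 (hadj x hx y hyA hyx.symm ?_), hyA⟩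
          by_cases hyu : y = u
          · exact Or.inr ⟨h.2, fun h' => huw (hyu.symm.trans h')⟩
          · exact Or.inl ⟨h.1, hyu⟩
        have := Finset.card_le_card this
        rw [Finset.card_erase_of_mem hx, hAc] at this
        omega
      · obtain ⟨z, hz⟩ : ∃ z, (A.erase x).erase z ⊆ nbrs V x ∩ A := by
          by_cases hxu : x = u
          · refine ⟨w, fun y hy => ?_⟩
            simp only [Finset.mem_erase] at hy
            exact Finset.mem_inter.2 ⟨mem_nbrs.2 (hadj x hx y hy.2.2 (Ne.symm hy.2.1)
              (Or.inr ⟨hxu ▸ huw, hy.1⟩)), hy.2.2⟩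
          · refine ⟨u, fun y hy => ?_⟩
            simp only [Finset.mem_erase] at hy
            exact Finset.mem_inter.2 ⟨mem_nbrs.2 (hadj x hx y hy.2.2 (Ne.symm hy.2.1)
              (Or.inl ⟨hxu, hy.1⟩)), hy.2.2⟩
        have := Finset.card_le_card hz
        have h2 := Finset.pred_card_le_card_erase (s := A.erase x) (a := z)
        rw [Finset.card_erase_of_mem hx, hAc] at h2
        omega
    rw [Finset.sum_add_distrib, Finset.sum_const, hAc] at h1
    exact h1
  have hfilter : A.filter (fun x => x ≠ u ∧ x ≠ w) = (A.erase u).erase w := by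
    ext x
    simp only [Finset.mem_filter, Finset.mem_erase]
    tauto
  rw [Finset.sum_add_distrib, Finset.sum_const, hAc, ← Finset.card_filter, hfilter,
    Finset.card_erase_of_mem (Finset.mem_erase.2 ⟨huw.symm, hwA⟩), Finset.card_erase_of_mem huA,
    hAc] at hlow
  have h1 := degSum_add_eq hAV
  have h2 := sum_card_nbrs_inter_add_le (V := V) (V \ A)
  have h3 : ∑ _s ∈ V \ A, 6 ≤ ∑ s ∈ V \ A, deg V s :=
    Finset.sum_le_sum fun s hs => H.six_le_deg (Finset.mem_sdiff.1 hs).1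
  have h4 := Finset.card_sdiff_add_card_eq_card hAV
  have h5 := H.card_eq
  have h6 : (V \ A).card = 5 := by omega
  rw [Finset.sum_const, h6] at h3
  rw [h6] at h2
  rw [H.degSum_eq] at h1
  norm_num at hlow h3
  omega

/-- Every simple vertex is avoided by five cofacets. -/
lemma exists_five_cofacets (H : IsCounterexample V) (hv : v ∈ V) (hdeg : deg V v = 6) :
    ∃ 𝒮 : Finset (Finset E), 𝒮.card = 5 ∧ ∀ O ∈ 𝒮, IsCofacet V O ∧ v ∉ O := by
  have hex : ∀ y, ∃ F, y ∈ nbrs V v → IsFace V F ∧ dim F = 5 ∧ v ∈ F ∧ y ∉ F ∧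
      ∀ x ∈ nbrs V v, x ≠ y → x ∈ F := by
    intro y
    by_cases hy : y ∈ nbrs V v
    · obtain ⟨F, hF, hFd, h1, h2, h3⟩ := exists_facet_of_simple H.convexPosition
        (hdeg.trans H.dim_eq.symm) (mem_nbrs.1 hy)
      exact ⟨F, fun _ => ⟨hF, by have := H.dim_eq; omega, h1, h2,
        fun x hx => h3 x (mem_nbrs.1 hx)⟩⟩
    · exact ⟨∅, fun h => absurd h hy⟩
  choose F hF using hex
  have hsmall : ((nbrs V v).filter fun y => (F y).card = 6).card ≤ 1 := by
    rw [Finset.card_le_one]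
    intro y hy z hz
    by_contra hyz
    have hsimplex : ∀ y ∈ (nbrs V v).filter (fun y => (F y).card = 6),
        F y = (insert v (nbrs V v)).erase y := by
      intro y hy
      obtain ⟨hy, hy6⟩ := Finset.mem_filter.1 hy
      obtain ⟨-, -, h3, -, h5⟩ := hF y hy
      refine (Finset.eq_of_subset_of_card_le (fun x hx => ?_) ?_).symm
      · obtain ⟨hxy, hx⟩ := Finset.mem_erase.1 hx
        rcases Finset.mem_insert.1 hx with rfl | hx
        · exact h3
        · exact h5 x hx hxy
      · rw [Finset.card_erase_of_mem (Finset.mem_insert_of_mem hy),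
          Finset.card_insert_of_notMem fun h => (mem_nbrs.1 h).1 rfl, ← deg, hdeg, hy6]
    have hy' := (Finset.mem_filter.1 hy).1
    have hz' := (Finset.mem_filter.1 hz).1
    exact H.false_of_two_simplices hdeg (mem_nbrs.1 hy') (mem_nbrs.1 hz') hyz
      (hF y hy').1 (hF y hy').2.1 (hsimplex y hy) (hF z hz').1 (hF z hz').2.1 (hsimplex z hz)
  set N := (nbrs V v).filter fun y => ¬ (F y).card = 6 with hN
  have hNcard : 5 ≤ N.card := by
    have : ((nbrs V v).filter fun y => (F y).card = 6).card + N.card = 6 := by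
      refine Eq.trans ?_ hdeg
      rw [hN, deg]
      convert Finset.card_filter_add_card_filter_not (s := nbrs V v) fun y => (F y).card = 6
    omega
  have hinj : Set.InjOn (fun y => V \ F y) N := by
    intro y hy z hz hyz
    rw [Finset.mem_coe, hN, Finset.mem_filter] at hy hz
    by_contra hne
    have h1 : y ∈ V \ F y := Finset.mem_sdiff.2 ⟨nbrs_subset hy.1, (hF y hy.1).2.2.2.1⟩
    have h2 : y ∈ V \ F z := by
      have h3 : V \ F y = V \ F z := hyz
      exact h3 ▸ h1
    exact (Finset.mem_sdiff.1 h2).2 ((hF z hz.1).2.2.2.2 y hy.1 hne)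
  obtain ⟨𝒮, h𝒮, hcard⟩ := Finset.exists_subset_card_eq
    (show 5 ≤ (N.image fun y => V \ F y).card by rwa [Finset.card_image_of_injOn hinj])
  refine ⟨𝒮, hcard, fun O hO => ?_⟩
  obtain ⟨y, hy, rfl⟩ := Finset.mem_image.1 (h𝒮 hO)
  obtain ⟨hy, hy6⟩ := Finset.mem_filter.1 hy
  obtain ⟨h1, h2, h3, h4, -⟩ := hF y hy
  have h5 := H.card_sdiff h1
  have h6 := H.facet_card_cases h1 h2
  refine ⟨⟨Finset.sdiff_subset, ?_, ⟨y, Finset.mem_sdiff.2 ⟨nbrs_subset hy, h4⟩⟩, by omega⟩,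
    fun h => (Finset.mem_sdiff.1 h).2 h3⟩
  rwa [Finset.sdiff_sdiff_eq_self h1.1]

/-- Removing cofacets one by one decreases the dimension. -/
lemma isFace_sdiff_biUnion (H : IsCounterexample V)
    {𝒮 : Finset (Finset E)} (h𝒮 : ∀ O ∈ 𝒮, IsCofacet V O)
    (hv : v ∈ V \ 𝒮.biUnion id) :
    IsFace V (V \ 𝒮.biUnion id) ∧ dim (V \ 𝒮.biUnion id) + 𝒮.card ≤ 6 := by
  induction 𝒮 using Finset.induction_on with
  | empty => simpa [H.dim_eq] using isFace_self V
  | insert O 𝒮 hO ih =>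
    have hOc := h𝒮 O (Finset.mem_insert_self _ _)
    have heq : V \ (insert O 𝒮).biUnion id = (V \ 𝒮.biUnion id) ∩ (V \ O) := by
      rw [Finset.biUnion_insert, id, Finset.union_comm, Finset.sdiff_union_distrib]
    rw [heq] at hv ⊢
    obtain ⟨h1, h2⟩ := ih (fun O' hO' => h𝒮 O' (Finset.mem_insert_of_mem hO'))
      (Finset.mem_inter.1 hv).1
    have hface := h1.inter hOc.2.1
    obtain ⟨x, hx⟩ := hOc.2.2.1
    have hxK : x ∈ V \ 𝒮.biUnion id := by
      refine Finset.mem_sdiff.2 ⟨hOc.1 hx, fun h => ?_⟩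
      obtain ⟨O', hO', hxO'⟩ := Finset.mem_biUnion.1 h
      exact Finset.disjoint_left.1 (H.disjoint_of_ne hOc (h𝒮 O' (Finset.mem_insert_of_mem hO'))
        (by rintro rfl; exact hO hO')) hx hxO'
    have hne : (V \ 𝒮.biUnion id) ∩ (V \ O) ≠ V \ 𝒮.biUnion id := fun h =>
      (Finset.mem_sdiff.1 (Finset.mem_inter.1 (h.symm ▸ hxK :
        x ∈ (V \ 𝒮.biUnion id) ∩ (V \ O))).2).2 hx
    have := (hface.restrict Finset.inter_subset_left h1.1).dim_lt hne hv
    rw [Finset.card_insert_of_notMem hO]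
    exact ⟨hface, by omega⟩

lemma card_biUnion (H : IsCounterexample V) {𝒮 : Finset (Finset E)} (h𝒮 : ∀ O ∈ 𝒮, IsCofacet V O) :
    (𝒮.biUnion id).card = ∑ O ∈ 𝒮, O.card :=
  Finset.card_biUnion fun O hO O' hO' hne => H.disjoint_of_ne (h𝒮 O hO) (h𝒮 O' hO') hne

lemma biUnion_subset {𝒮 : Finset (Finset E)} (h𝒮 : ∀ O ∈ 𝒮, IsCofacet V O) :
    𝒮.biUnion id ⊆ V := Finset.biUnion_subset.2 fun O hO => (h𝒮 O hO).1

/-- Every simple vertex is avoided by five cofacets, each of which is a pair. -/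
lemma exists_five_pairs (H : IsCounterexample V) (hv : v ∈ V) (hdeg : deg V v = 6) :
    ∃ 𝒮 : Finset (Finset E), 𝒮.card = 5 ∧ ∀ O ∈ 𝒮, IsCofacet V O ∧ O.card = 2 ∧ v ∉ O := by
  obtain ⟨𝒮, hcard, h𝒮⟩ := H.exists_five_cofacets hv hdeg
  have hco : ∀ O ∈ 𝒮, IsCofacet V O := fun O hO => (h𝒮 O hO).1
  have hvK : v ∈ V \ 𝒮.biUnion id := by
    refine Finset.mem_sdiff.2 ⟨hv, fun h => ?_⟩
    obtain ⟨O, hO, hvO⟩ := Finset.mem_biUnion.1 h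
    exact (h𝒮 O hO).2 hvO
  obtain ⟨hface, hd⟩ := H.isFace_sdiff_biUnion hco hvK
  have h1 := card_le_two (H.convexPosition.mono hface.1) (by omega)
  have h2 := Finset.card_sdiff_add_card_eq_card (biUnion_subset hco)
  rw [H.card_biUnion hco, H.card_eq] at h2
  refine ⟨𝒮, hcard, fun O hO => ⟨hco O hO, ?_, (h𝒮 O hO).2⟩⟩
  have h3 := Finset.add_sum_erase 𝒮 Finset.card hO
  have h4 : ∑ O ∈ 𝒮.erase O, O.card ≤ ∑ _O ∈ 𝒮.erase O, 2 :=
    Finset.sum_le_sum fun O' hO' => (hco O' (Finset.mem_of_mem_erase hO')).2.2.2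
  rw [Finset.sum_const, Finset.card_erase_of_mem hO, hcard, smul_eq_mul] at h4
  have h5 := (hco O hO).2.2.2
  omega

lemma six_le_card_simple (H : IsCounterexample V) : 6 ≤ (V.filter fun v => deg V v = 6).card := by
  have h1 : ∑ v ∈ V, 7 ≤ ∑ v ∈ V, (deg V v + if deg V v = 6 then 1 else 0) :=
    Finset.sum_le_sum fun v hv => by
      have := H.six_le_deg hv
      split_ifs <;> omega
  rw [Finset.sum_add_distrib, ← Finset.card_filter, ← degSum, H.degSum_eq, Finset.sum_const,
    H.card_eq, smul_eq_mul] at h1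
  omega

/-- The vertices are partitioned into six pairs, each of which is a cofacet. -/
lemma exists_six_pairs (H : IsCounterexample V) :
    ∃ 𝒯 : Finset (Finset E), 𝒯.card = 6 ∧ 𝒯.biUnion id = V ∧
      ∀ O ∈ 𝒯, IsCofacet V O ∧ O.card = 2 := by
  have hsimple := H.six_le_card_simple
  obtain ⟨v, hv⟩ := Finset.card_pos.1 (show 0 < (V.filter fun v => deg V v = 6).card by omega)
  obtain ⟨hv, hv6⟩ := Finset.mem_filter.1 hv
  obtain ⟨𝒮, hcard, h𝒮⟩ := H.exists_five_pairs hv hv6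
  have hunion : ∀ {𝒰 : Finset (Finset E)}, (∀ O ∈ 𝒰, IsCofacet V O ∧ O.card = 2) →
      (𝒰.biUnion id).card = 𝒰.card * 2 := fun {𝒰} h𝒰 => by
    rw [H.card_biUnion fun O hO => (h𝒰 O hO).1, Finset.sum_congr rfl fun O hO => (h𝒰 O hO).2,
      Finset.sum_const, smul_eq_mul]
  have h𝒮c : ∀ O ∈ 𝒮, IsCofacet V O ∧ O.card = 2 := fun O hO => ⟨(h𝒮 O hO).1, (h𝒮 O hO).2.1⟩
  obtain ⟨w, hw, hw6, hwU⟩ : ∃ w ∈ V, deg V w = 6 ∧ w ∈ 𝒮.biUnion id := by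
    by_contra! hn
    have hsub : (V.filter fun v => deg V v = 6) ⊆ V \ 𝒮.biUnion id := fun x hx => by
      rw [Finset.mem_filter] at hx
      exact Finset.mem_sdiff.2 ⟨hx.1, hn x hx.1 hx.2⟩
    have h1 := Finset.card_le_card hsub
    have h2 := Finset.card_sdiff_add_card_eq_card (biUnion_subset fun O hO => (h𝒮c O hO).1)
    rw [hunion h𝒮c, H.card_eq] at h2
    omega
  obtain ⟨𝒰, hcard', h𝒰⟩ := H.exists_five_pairs hw hw6
  obtain ⟨O', hO', hO'S⟩ : ∃ O' ∈ 𝒰, O' ∉ 𝒮 := by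
    by_contra! hn
    have heq : 𝒰 = 𝒮 := Finset.eq_of_subset_of_card_le hn (by omega)
    obtain ⟨O, hO, hwO⟩ := Finset.mem_biUnion.1 hwU
    exact (h𝒰 O (heq ▸ hO)).2.2 hwO
  have h𝒯 : ∀ O ∈ insert O' 𝒮, IsCofacet V O ∧ O.card = 2 := fun O hO => by
    rcases Finset.mem_insert.1 hO with rfl | hO
    · exact ⟨(h𝒰 O hO').1, (h𝒰 O hO').2.1⟩
    · exact h𝒮c O hO
  have h𝒯c : (insert O' 𝒮).card = 6 := by rw [Finset.card_insert_of_notMem hO'S, hcard]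
  refine ⟨insert O' 𝒮, h𝒯c, Finset.eq_of_subset_of_card_le
    (biUnion_subset fun O hO => (h𝒯 O hO).1) ?_, h𝒯⟩
  rw [hunion h𝒯, h𝒯c, H.card_eq]

theorem false (H : IsCounterexample V) : False := by
  obtain ⟨𝒯, hcard, hunion, h𝒯⟩ := H.exists_six_pairs
  have hsub : ∀ 𝒰 ⊆ 𝒯, 𝒰.biUnion id = V \ (𝒯 \ 𝒰).biUnion id := by
    intro 𝒰 h𝒰
    ext x
    rw [Finset.mem_sdiff, ← hunion]
    simp only [Finset.mem_biUnion, id]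
    constructor
    · rintro ⟨O, hO, hxO⟩
      refine ⟨⟨O, h𝒰 hO, hxO⟩, ?_⟩
      rintro ⟨O', hO', hxO'⟩
      obtain ⟨hO'T, hO'U⟩ := Finset.mem_sdiff.1 hO'
      exact Finset.disjoint_left.1 (H.disjoint_of_ne (h𝒯 O (h𝒰 hO)).1 (h𝒯 O' hO'T).1
        (fun h => hO'U (h ▸ hO))) hxO hxO'
    · rintro ⟨⟨O, hO, hxO⟩, hn⟩
      refine ⟨O, ?_, hxO⟩
      by_contra hOU
      exact hn ⟨O, Finset.mem_sdiff.2 ⟨hO, hOU⟩, hxO⟩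
  have hface : ∀ 𝒰 ⊆ 𝒯, ∀ x ∈ 𝒰.biUnion id,
      IsFace V (𝒰.biUnion id) ∧ dim (𝒰.biUnion id) ≤ 𝒰.card := by
    intro 𝒰 h𝒰 x hx
    rw [hsub 𝒰 h𝒰] at hx
    have h1 := H.isFace_sdiff_biUnion
      (fun O hO => (h𝒯 O (Finset.mem_sdiff.1 hO).1).1) hx
    rw [← hsub 𝒰 h𝒰] at h1
    have h2 := Finset.card_sdiff_add_card_eq_card h𝒰
    exact ⟨h1.1, by omega⟩
  have hdeg : ∀ a ∈ V, deg V a ≤ 6 := by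
    intro a ha
    obtain ⟨O₀, hO₀, haO₀⟩ := Finset.mem_biUnion.1 (hunion.symm ▸ ha : a ∈ 𝒯.biUnion id)
    rw [id] at haO₀
    have h0 := (h𝒯 O₀ hO₀).2
    obtain ⟨a', ha'⟩ := Finset.card_eq_one.1
      (show (O₀.erase a).card = 1 by rw [Finset.card_erase_of_mem haO₀, h0])
    have ha'm : a' ∈ O₀.erase a := ha' ▸ Finset.mem_singleton_self a'
    have hpair : O₀ = {a, a'} := by rw [← ha', Finset.insert_erase haO₀]
    have hadj : Adj V a a' := by
      refine ⟨(Finset.mem_erase.1 ha'm).1.symm, ?_⟩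
      have := (hface {O₀} (by simpa using hO₀) a (by simpa using haO₀)).1
      rwa [Finset.singleton_biUnion, id, hpair] at this
    have hle : ∀ O ∈ 𝒯, (nbrs V a ∩ O).card ≤ 1 := by
      intro O hO
      by_cases hOO : O = O₀
      · have := card_nbrs_inter_lt (V := V) haO₀
        rw [hOO]
        omega
      · have hK := hface {O₀, O} (Finset.insert_subset hO₀ (by simpa using hO)) a
          (by simp [haO₀])
        have hKe : ({O₀, O} : Finset (Finset E)).biUnion id = O₀ ∪ O := by
          rw [Finset.biUnion_insert, Finset.singleton_biUnion, id, id]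
        rw [Finset.card_pair (Ne.symm hOO), hKe] at hK
        rw [Finset.card_le_one]
        intro b hb c hc
        by_contra hbc
        rw [Finset.mem_inter, mem_nbrs] at hb hc
        have haK : a ∈ O₀ ∪ O := Finset.mem_union_left _ haO₀
        have ha'O := (Finset.mem_erase.1 ha'm).2
        have hdisj := Finset.disjoint_left.1
          (H.disjoint_of_ne (h𝒯 O₀ hO₀).1 (h𝒯 O hO).1 (Ne.symm hOO)) ha'O
        refine not_three_adj hK.2
          (hK.1.adj_iff.2 ⟨hadj, haK, Finset.mem_union_left _ ha'O⟩)
          (hK.1.adj_iff.2 ⟨hb.1, haK, Finset.mem_union_right _ hb.2⟩)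
          (hK.1.adj_iff.2 ⟨hc.1, haK, Finset.mem_union_right _ hc.2⟩) ?_ ?_ hbc
        · rintro rfl; exact hdisj hb.2
        · rintro rfl; exact hdisj hc.2
    have hcover : nbrs V a ⊆ 𝒯.biUnion fun O => nbrs V a ∩ O := fun x hx => by
      obtain ⟨O, hO, hxO⟩ :=
        Finset.mem_biUnion.1 (hunion.symm ▸ nbrs_subset hx : x ∈ 𝒯.biUnion id)
      exact Finset.mem_biUnion.2 ⟨O, hO, Finset.mem_inter.2 ⟨hx, hxO⟩⟩
    have h1 := Finset.card_le_card hcover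
    have h2 := Finset.card_biUnion_le_card_mul 𝒯 (fun O => nbrs V a ∩ O) 1 hle
    rw [deg]
    omega
  have : degSum V ≤ ∑ _v ∈ V, 6 := Finset.sum_le_sum hdeg
  rw [H.degSum_eq, Finset.sum_const, H.card_eq] at this
  norm_num at this

end IsCounterexample

end Cofacets

section ConvexHull

variable {E : Type*} [AddCommGroup E] [Module ℝ E] {V F : Finset E} {u v w : E} {B : Set E}

lemma le_of_mem_convexHull {f : E →ₗ[ℝ] ℝ} {c : ℝ} {x : E} (hf : ∀ v ∈ V, f v ≤ c)
    (hx : x ∈ convexHull ℝ (V : Set E)) : f x ≤ c :=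
  convexHull_min (t := {x | f x ≤ c}) hf (convex_halfSpace_le f.isLinear c) hx

lemma eq_of_mem_convexHull {f : E →ₗ[ℝ] ℝ} {c : ℝ} {x : E} (hf : ∀ v ∈ V, f v = c)
    (hx : x ∈ convexHull ℝ (V : Set E)) : f x = c :=
  convexHull_min (t := {x | f x = c}) hf (convex_hyperplane f.isLinear c) hx

lemma mem_convexHull_of_eq {f : E →ₗ[ℝ] ℝ} {c : ℝ} {x : E} (hFV : F ⊆ V)
    (hf : ∀ v ∈ F, f v = c) (hf' : ∀ v ∈ V, v ∉ F → f v < c)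
    (hx : x ∈ convexHull ℝ (V : Set E)) (hxc : f x = c) : x ∈ convexHull ℝ (F : Set E) := by
  obtain ⟨w, hw, hw1, rfl⟩ := Finset.mem_convexHull'.1 hx
  have hsum : ∑ y ∈ V, w y * (c - f y) = 0 := by
    simp only [mul_sub, Finset.sum_sub_distrib, ← Finset.sum_mul, hw1, one_mul]
    simpa [sub_eq_zero] using hxc.symm
  have hle : ∀ y ∈ V, f y ≤ c := fun y hy => by
    by_cases h : y ∈ F
    · exact (hf y h).le
    · exact (hf' y hy h).le
  have hzero := (Finset.sum_eq_zero_iff_of_nonneg fun y hy =>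
    mul_nonneg (hw y hy) (sub_nonneg.2 (hle y hy))).1 hsum
  have hw0 : ∀ y ∈ V, y ∉ F → w y = 0 := fun y hy hyF =>
    (mul_eq_zero.1 (hzero y hy)).resolve_right (sub_pos.2 (hf' y hy hyF)).ne'
  refine Finset.mem_convexHull'.2 ⟨w, fun y hy => hw y (hFV hy), ?_, ?_⟩
  · rw [← hw1]
    exact Finset.sum_subset hFV hw0
  · exact Finset.sum_subset hFV fun y hy hyF => by rw [hw0 y hy hyF, zero_smul]

lemma IsFace.mem_of_mem_convexHull (hF : IsFace V F) (hv : v ∈ V)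
    (h : v ∈ convexHull ℝ (F : Set E)) : v ∈ F := by
  obtain ⟨-, f, c, hf, hf'⟩ := hF
  by_contra hn
  exact (hf' v hv hn).ne (eq_of_mem_convexHull hf h)

lemma IsFace.isExtreme (hF : IsFace V F) :
    IsExtreme ℝ (convexHull ℝ (V : Set E)) (convexHull ℝ (F : Set E)) := by
  obtain ⟨hFV, f, c, hf, hf'⟩ := hF
  have hle : ∀ y ∈ V, f y ≤ c := fun y hy => by
    by_cases h : y ∈ F
    · exact (hf y h).le
    · exact (hf' y hy h).le
  refine ⟨convexHull_mono (Finset.coe_subset.2 hFV), ?_⟩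
  rintro x hx y hy z hz ⟨a, b, ha, hb, hab, rfl⟩
  refine mem_convexHull_of_eq hFV hf hf' hx ?_
  have h1 := le_of_mem_convexHull hle hx
  have h2 := le_of_mem_convexHull hle hy
  have h3 := eq_of_mem_convexHull hf hz
  simp only [map_add, map_smul, smul_eq_mul] at h3
  refine h1.antisymm (not_lt.1 fun h => ?_)
  have h4 : a * c + b * c = c := by rw [← add_mul, hab, one_mul]
  linarith [mul_lt_mul_of_pos_left h ha, mul_le_mul_of_nonneg_left h2 hb.le]

lemma mem_of_weight_pos (hB : IsExtreme ℝ (convexHull ℝ (V : Set E)) B) {g : E → ℝ}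
    (hg : ∀ y ∈ V, 0 ≤ g y) (hg1 : ∑ y ∈ V, g y = 1) (hx : ∑ y ∈ V, g y • y ∈ B)
    (hv : v ∈ V) (hpos : 0 < g v) : v ∈ B := by
  have hsum := Finset.add_sum_erase V g hv
  have hvec := Finset.add_sum_erase V (fun y => g y • y) hv
  have hnonneg : ∀ y ∈ V.erase v, 0 ≤ g y := fun y hy => hg y (Finset.mem_of_mem_erase hy)
  rcases (Finset.sum_nonneg hnonneg).eq_or_lt with h0 | h0
  · have hz := (Finset.sum_eq_zero_iff_of_nonneg hnonneg).1 h0.symm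
    rw [← hvec, Finset.sum_eq_zero fun y hy => by rw [hz y hy, zero_smul], add_zero] at hx
    have : g v = 1 := by linarith
    simpa [this] using hx
  · have hmem := Finset.centerMass_mem_convexHull (s := (V : Set E)) (V.erase v) hnonneg h0
      (z := id) fun y hy => Finset.mem_coe.2 (Finset.mem_of_mem_erase hy)
    refine hB.left_mem_of_mem_openSegment (subset_convexHull ℝ _ (Finset.mem_coe.2 hv)) hmem hx
      ⟨g v, ∑ y ∈ V.erase v, g y, hpos, h0, by linarith, ?_⟩
    rw [Finset.centerMass, smul_smul, mul_inv_cancel₀ h0.ne', one_smul, ← hvec]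
    rfl

/-- A convex extreme subset of a polytope is spanned by the vertices that it contains. -/
lemma eq_convexHull_filter (hB : IsExtreme ℝ (convexHull ℝ (V : Set E)) B) (hc : Convex ℝ B) :
    B = convexHull ℝ (V.filter (· ∈ B) : Finset E) := by
  refine Set.Subset.antisymm (fun x hx => ?_)
    (convexHull_min (fun y hy => (Finset.mem_filter.1 (Finset.mem_coe.1 hy)).2) hc)
  obtain ⟨g, hg, hg1, rfl⟩ := Finset.mem_convexHull'.1 (hB.subset hx)
  have hzero : ∀ y ∈ V, y ∉ V.filter (· ∈ B) → g y = 0 := fun y hy hyB => by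
    by_contra hne
    exact hyB (Finset.mem_filter.2 ⟨hy,
      mem_of_weight_pos hB hg hg1 hx hy (lt_of_le_of_ne (hg y hy) (Ne.symm hne))⟩)
  refine Finset.mem_convexHull'.2 ⟨g, fun y hy => hg y (Finset.mem_filter.1 hy).1, ?_, ?_⟩
  · rw [← hg1]
    exact Finset.sum_subset (Finset.filter_subset _ _) hzero
  · exact Finset.sum_subset (Finset.filter_subset _ _)
      fun y hy hyF => by rw [hzero y hy hyF, zero_smul]

lemma vectorSpan_convexHull (s : Set E) : vectorSpan ℝ (convexHull ℝ s) = vectorSpan ℝ s := by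
  rw [← direction_affineSpan, affineSpan_convexHull, direction_affineSpan]

lemma dim_pair (h : u ≠ v) : dim {u, v} = 1 := by
  rw [dim, Finset.coe_pair, vectorSpan_pair]
  exact finrank_span_singleton (sub_ne_zero.2 h)

lemma dim_eq_one_of_card_eq_two (h : F.card = 2) : dim F = 1 := by
  obtain ⟨u, v, huv, rfl⟩ := Finset.card_eq_two.1 h
  exact dim_pair huv

lemma deg_eq_card_filter :
    deg V v = (((V.powersetCard 2).filter (IsFace V)).filter (v ∈ ·)).card := by
  rw [deg]
  refine Finset.card_bij (fun w _ => {v, w}) (fun w hw => ?_) (fun a ha b hb h => ?_)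
    (fun e he => ?_)
  · rw [mem_nbrs] at hw
    simp only [Finset.mem_filter, Finset.mem_powersetCard]
    exact ⟨⟨⟨hw.2.1, Finset.card_pair hw.1⟩, hw.2⟩, by simp⟩
  · have hb' : b ∈ ({v, a} : Finset E) := h ▸ by simp
    rw [Finset.mem_insert, Finset.mem_singleton] at hb'
    exact (hb'.resolve_left fun h => (mem_nbrs.1 hb).1 h.symm).symm
  · simp only [Finset.mem_filter, Finset.mem_powersetCard] at he
    obtain ⟨⟨⟨-, hcard⟩, hface⟩, hv⟩ := he
    obtain ⟨w, hw⟩ := Finset.card_eq_one.1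
      (show (e.erase v).card = 1 by rw [Finset.card_erase_of_mem hv, hcard])
    have hwm : w ∈ e.erase v := hw ▸ Finset.mem_singleton_self w
    have heq : {v, w} = e := by rw [← hw, Finset.insert_erase hv]
    exact ⟨w, mem_nbrs.2 ⟨(Finset.mem_erase.1 hwm).1.symm, heq ▸ hface⟩, heq⟩

lemma degSum_eq_two_mul : degSum V = 2 * ((V.powersetCard 2).filter (IsFace V)).card := by
  have h := Finset.sum_card_bipartiteAbove_eq_sum_card_bipartiteBelow (fun (v : E) e => v ∈ e)
    (s := V) (t := (V.powersetCard 2).filter (IsFace V))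
  have h1 : degSum V = ∑ v ∈ V, (Finset.bipartiteAbove (fun (v : E) e => v ∈ e)
      ((V.powersetCard 2).filter (IsFace V)) v).card :=
    Finset.sum_congr rfl fun v _ => deg_eq_card_filter
  rw [h1, h, mul_comm, ← smul_eq_mul, ← Finset.sum_const]
  refine Finset.sum_congr rfl fun e he => ?_
  obtain ⟨hsub, hcard⟩ := Finset.mem_powersetCard.1 (Finset.mem_filter.1 he).1
  rw [← hcard, Finset.bipartiteBelow, Finset.filter_mem_eq_inter, Finset.inter_eq_right.2 hsub]

end ConvexHull

section Separation

variable {E : Type*} [NormedAddCommGroup E] [NormedSpace ℝ E] {V F : Finset E} {u v : E}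
  {B : Set E}

lemma convexPosition_of_notMem (h : ∀ v ∈ V, v ∉ convexHull ℝ ((V : Set E) \ {v})) :
    ConvexPosition V := by
  intro v hv
  obtain ⟨f, c, hf, hfv⟩ := geometric_hahn_banach_closed_point (convex_convexHull ℝ _)
    (Set.Finite.isClosed_convexHull ℝ (V.finite_toSet.sdiff)) (h v hv)
  refine ⟨by simpa using hv, f.toLinearMap, f v, by simp, fun u hu huv => ?_⟩
  exact (hf u (subset_convexHull ℝ _ ⟨hu, by simpa using huv⟩)).trans hfv

lemma lineMap_notMem_of_one_lt (hV : ConvexPosition V) (hu : u ∈ V) (hv : v ∈ V) (huv : u ≠ v)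
    {t : ℝ} (ht : 1 < t) : AffineMap.lineMap u v t ∉ convexHull ℝ (V : Set E) := by
  intro hmem
  obtain ⟨-, f, c, hf, hf'⟩ := hV v hv
  have hle : ∀ y ∈ V, f y ≤ c := fun y hy => by
    by_cases h : y ∈ ({v} : Finset E)
    · exact (hf y h).le
    · exact (hf' y hy h).le
  have h1 := le_of_mem_convexHull hle hmem
  have h2 := hf v (by simp)
  have h3 := hf' u hu (by simpa using huv)
  rw [AffineMap.lineMap_apply_module', map_add, map_smul, map_sub, smul_eq_mul] at h1
  nlinarith

lemma isFace_pair_of_isExtreme (hV : ConvexPosition V) (huv : u ≠ v)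
    (hB : IsExtreme ℝ (convexHull ℝ (V : Set E)) B) (hc : Convex ℝ B)
    (h : V.filter (· ∈ B) = {u, v}) : IsFace V {u, v} := by
  have huB : u ∈ V.filter (· ∈ B) := by simp [h]
  have hvB : v ∈ V.filter (· ∈ B) := by simp [h]
  rw [Finset.mem_filter] at huB hvB
  have hdisj : Disjoint (convexHull ℝ ((V \ {u, v} : Finset E) : Set E))
      (line[ℝ, u, v] : Set E) := by
    rw [Set.disjoint_left]
    intro z hz hzl
    have hzV : z ∈ convexHull ℝ (V : Set E) :=
      convexHull_mono (Finset.coe_subset.2 Finset.sdiff_subset) hz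
    obtain ⟨t, rfl⟩ := mem_affineSpan_pair_iff_exists_lineMap_eq.1 hzl
    rcases lt_or_ge 1 t with ht | ht
    · exact lineMap_notMem_of_one_lt hV huB.1 hvB.1 huv ht hzV
    rcases lt_or_ge t 0 with ht' | ht'
    · rw [← AffineMap.lineMap_apply_one_sub] at hzV
      exact lineMap_notMem_of_one_lt hV hvB.1 huB.1 huv.symm (by linarith) hzV
    have hzB : AffineMap.lineMap u v t ∈ B :=
      hc.lineMap_mem huB.2 hvB.2 ⟨ht', ht⟩
    obtain ⟨g, hg, hg1, hgz⟩ := Finset.mem_convexHull'.1 hz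
    obtain ⟨y, hy, hpos⟩ : ∃ y ∈ V \ {u, v}, 0 < g y := by
      by_contra! hn
      linarith [Finset.sum_nonpos hn]
    have hyB := mem_of_weight_pos (V := V \ {u, v})
      (B := B ∩ convexHull ℝ ((V \ {u, v} : Finset E) : Set E)) ⟨Set.inter_subset_right, fun a ha b hb c hcB hab =>
        ⟨hB.left_mem_of_mem_openSegment
        (convexHull_mono (Finset.coe_subset.2 Finset.sdiff_subset) ha)
        (convexHull_mono (Finset.coe_subset.2 Finset.sdiff_subset) hb) hcB.1 hab, ha⟩⟩
      hg hg1 ⟨hgz ▸ hzB, hgz ▸ hz⟩ hy hpos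
    rw [Finset.mem_sdiff] at hy
    exact hy.2 (h ▸ Finset.mem_filter.2 ⟨hy.1, hyB.1⟩)
  obtain ⟨f, a, b, hfa, hab, hfb⟩ := geometric_hahn_banach_compact_closed (convex_convexHull ℝ _)
    (Set.Finite.isCompact_convexHull ℝ (Finset.finite_toSet _)) (AffineSubspace.convex _)
    (AffineSubspace.closed_of_finiteDimensional _) hdisj
  have hline : ∀ t : ℝ, b < f u + t * (f v - f u) := fun t => by
    have := hfb _ (AffineMap.lineMap_mem_affineSpan_pair t u v)
    rw [AffineMap.lineMap_apply_module', map_add, map_smul, map_sub, smul_eq_mul] at this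
    linarith
  have heq : f v = f u := by
    by_contra hne
    have h1 := hline ((b - f u) / (f v - f u))
    rw [div_mul_cancel₀ _ (sub_ne_zero.2 hne)] at h1
    linarith
  refine ⟨by simp [Finset.insert_subset_iff, huB.1, hvB.1], f.toLinearMap, f u, ?_, ?_⟩
  · intro x hx
    rw [Finset.mem_insert, Finset.mem_singleton] at hx
    rcases hx with rfl | rfl
    · rfl
    · exact heq
  · intro x hx hxn
    have h1 := hfa x (subset_convexHull ℝ _ (Finset.mem_coe.2 (Finset.mem_sdiff.2 ⟨hx, hxn⟩)))
    have h2 := hline 0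
    simp only [zero_mul, add_zero] at h2
    exact (h1.trans hab).trans h2

lemma exists_isFace_eq (hV : ConvexPosition V)
    (hB : IsExtreme ℝ (convexHull ℝ (V : Set E)) B) (hc : Convex ℝ B)
    (hdim : Module.finrank ℝ (vectorSpan ℝ B) = 1) :
    ∃ F, IsFace V F ∧ F.card = 2 ∧ convexHull ℝ (F : Set E) = B := by
  have heq := eq_convexHull_filter hB hc
  have hd : dim (V.filter (· ∈ B)) = 1 := by
    rw [dim, ← vectorSpan_convexHull, ← heq, hdim]
  obtain ⟨p, hp⟩ := nonempty_of_dim_pos (show 0 < dim (V.filter (· ∈ B)) by omega)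
  have h1 := dim_lt_card hp
  have h2 := card_le_two (hV.mono (Finset.filter_subset (· ∈ B) V)) (by omega)
  have h3 : (V.filter (· ∈ B)).card = 2 := by omega
  obtain ⟨u, v, huv, h4⟩ := Finset.card_eq_two.1 h3
  exact ⟨_, h4 ▸ isFace_pair_of_isExtreme hV huv hB hc h4, h3, heq.symm⟩

end Separation

section Polytopes

variable {n : ℕ} {V : Finset (Fin n → ℝ)} {P : Set (Fin n → ℝ)}

lemma isEdge_iff (hV : ConvexPosition V) {e : Set (Fin n → ℝ)} :
    IsEdge (convexHull ℝ (V : Set (Fin n → ℝ))) e ↔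
      e ∈ ((V.powersetCard 2).filter (IsFace V)).image
        fun F : Finset (Fin n → ℝ) => convexHull ℝ (F : Set (Fin n → ℝ)) := by
  rw [Finset.mem_image]
  constructor
  · rintro ⟨hext, hconv, hdim⟩
    obtain ⟨F, hF, hcard, heq⟩ := exists_isFace_eq hV hext hconv hdim
    exact ⟨F, Finset.mem_filter.2 ⟨Finset.mem_powersetCard.2 ⟨hF.1, hcard⟩, hF⟩, heq⟩
  · rintro ⟨F, hF, rfl⟩
    obtain ⟨hF, hface⟩ := Finset.mem_filter.1 hF
    refine ⟨hface.isExtreme, convex_convexHull ℝ _, ?_⟩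
    rw [adim, vectorSpan_convexHull]
    exact dim_eq_one_of_card_eq_two (Finset.mem_powersetCard.1 hF).2

lemma degSum_eq_two_mul_f₁ (hV : ConvexPosition V) :
    degSum V = 2 * f₁ (convexHull ℝ (V : Set (Fin n → ℝ))) := by
  have h : {e | IsEdge (convexHull ℝ (V : Set (Fin n → ℝ))) e} =
      (((V.powersetCard 2).filter (IsFace V)).image
        fun F : Finset (Fin n → ℝ) => convexHull ℝ (F : Set (Fin n → ℝ)) : Finset _) := by
    ext e
    exact isEdge_iff hV
  rw [degSum_eq_two_mul, f₁, h, Set.ncard_coe_finset, Finset.card_image_of_injOn]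
  intro F hF G hG hFG
  rw [Finset.mem_coe, Finset.mem_filter] at hF hG
  have hsub : ∀ {F G : Finset (Fin n → ℝ)}, IsFace V F → IsFace V G →
      convexHull ℝ (F : Set (Fin n → ℝ)) = convexHull ℝ (G : Set (Fin n → ℝ)) → F ⊆ G :=
    fun hF hG h x hx => hG.mem_of_mem_convexHull (hF.1 hx)
      (h ▸ subset_convexHull ℝ _ (Finset.mem_coe.2 hx))
  exact Finset.Subset.antisymm (hsub hF.2 hG.2 hFG) (hsub hG.2 hF.2 hFG.symm)

lemma IsPolytope.exists_convexPosition (hP : IsPolytope P) (hfin : (extremePoints ℝ P).Finite) :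
    ∃ V : Finset (Fin n → ℝ), P = convexHull ℝ (V : Set (Fin n → ℝ)) ∧ ConvexPosition V ∧
      V.card = f₀ P := by
  obtain ⟨S, rfl⟩ := hP
  set P := convexHull ℝ (S : Set (Fin n → ℝ)) with hP
  have hconv : Convex ℝ P := convex_convexHull ℝ _
  have hcomp : IsCompact P := Set.Finite.isCompact_convexHull ℝ S.finite_toSet
  refine ⟨hfin.toFinset, ?_, convexPosition_of_notMem fun v hv => ?_, ?_⟩
  · rw [hfin.coe_toFinset, ← (Set.Finite.isClosed_convexHull ℝ hfin).closure_eq,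
      closure_convexHull_extremePoints hcomp hconv]
  · rw [hfin.coe_toFinset]
    exact convexIndependent_set_iff_notMem_convexHull_sdiff.1
      hconv.convexIndependent_extremePoints v
      (hfin.mem_toFinset.1 hv)
  · rw [f₀, Set.ncard_eq_toFinset_card _ hfin]

end Polytopes

end PolytopeGraph

/-- There is no 6-polytope with 12 vertices and 39 edges. -/
theorem stmt5 : (12, 39) ∉ fPairs 6 := by
  rintro ⟨n, P, ⟨hP, hdim⟩, h₀, h₁⟩
  have hfin : (Set.extremePoints ℝ P).Finite :=
    Set.finite_of_ncard_ne_zero (by rw [← f₀, h₀]; norm_num)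
  obtain ⟨V, rfl, hV, hcard⟩ := PolytopeGraph.IsPolytope.exists_convexPosition hP hfin
  refine PolytopeGraph.IsCounterexample.false ⟨hV, ?_, hcard.trans h₀, ?_⟩
  · rwa [adim, PolytopeGraph.vectorSpan_convexHull] at hdim
  · rw [PolytopeGraph.degSum_eq_two_mul_f₁ hV, h₁]
    norm_num
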